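/- For all integers m ≥ 0 and l with 2m ≤ l ≤ n, one has the equality of R-submodules V_{l,m}^g·B_{l−2m} = V_{l,m}·B_{l−2m} inside B_n^k(R). -/

import Mathlib

/-!
Cyclotomic BMW algebra `B_n^k(R)`, presented as the quotient of the free `R`-algebra on
generators `Y, Y⁻¹, Xᵢ, Xᵢ⁻¹ (1 ≤ i ≤ n-1), eᵢ (1 ≤ i ≤ n-1)` by the defining relations.
Generators with out-of-range indices are identified with `1` (resp. `0` for the `eᵢ`),
so that the quotient is exactly the cyclotomic BMW algebra.
-/

inductive BMWGen : Type
  | Y : BMWGen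
  | Yinv : BMWGen
  | X : ℕ → BMWGen
  | Xinv : ℕ → BMWGen
  | E : ℕ → BMWGen

namespace CBMW

/-- The parameters of a cyclotomic BMW algebra: `n`, `k`, units `q, λ, q₀` and
families `qc` (the `qᵢ`, with `qc 0 = q₀`) and `A` (the `Aᵢ`). -/
structure Params (R : Type) [CommRing R] where
  n : ℕ
  k : ℕ
  q : Rˣ
  lam : Rˣ
  q0 : Rˣ
  qc : ℕ → R
  A : ℕ → R

variable {R : Type} [CommRing R]

abbrev F (R : Type) [CommRing R] := FreeAlgebra R BMWGen

def fY : F R := FreeAlgebra.ι R BMWGen.Y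
def fYi : F R := FreeAlgebra.ι R BMWGen.Yinv
def fX (i : ℕ) : F R := FreeAlgebra.ι R (BMWGen.X i)
def fXi (i : ℕ) : F R := FreeAlgebra.ι R (BMWGen.Xinv i)
def fE (i : ℕ) : F R := FreeAlgebra.ι R (BMWGen.E i)

/-- `δ = q - q⁻¹`. -/
def Params.delta (P : Params R) : R := (P.q : R) - ((P.q⁻¹ : Rˣ) : R)

/-- `λ⁻¹` as an element of `R`. -/
def Params.laminv (P : Params R) : R := ((P.lam⁻¹ : Rˣ) : R)

/-- The defining relations of the cyclotomic BMW algebra. -/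
inductive Rel (P : Params R) : F R → F R → Prop
  | X_inv_right {i : ℕ} (h1 : 1 ≤ i) (h2 : i ≤ P.n - 1) : Rel P (fX i * fXi i) 1
  | X_inv_left {i : ℕ} (h1 : 1 ≤ i) (h2 : i ≤ P.n - 1) : Rel P (fXi i * fX i) 1
  | Y_inv_right : Rel P (fY * fYi) 1
  | Y_inv_left : Rel P (fYi * fY) 1
  | X_invalid {i : ℕ} (h : i = 0 ∨ P.n - 1 < i) : Rel P (fX i) 1
  | Xi_invalid {i : ℕ} (h : i = 0 ∨ P.n - 1 < i) : Rel P (fXi i) 1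
  | E_invalid {i : ℕ} (h : i = 0 ∨ P.n - 1 < i) : Rel P (fE i) 0
  | skein {i : ℕ} (h1 : 1 ≤ i) (h2 : i ≤ P.n - 1) :
      Rel P (fX i - fXi i) (P.delta • ((1 : F R) - fE i))
  | XX_far {i j : ℕ} (h1 : 1 ≤ i) (h2 : i ≤ P.n - 1) (h3 : 1 ≤ j) (h4 : j ≤ P.n - 1)
      (h : i + 2 ≤ j ∨ j + 2 ≤ i) : Rel P (fX i * fX j) (fX j * fX i)
  | braid {i : ℕ} (h1 : 1 ≤ i) (h2 : i + 1 ≤ P.n - 1) :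
      Rel P (fX i * fX (i+1) * fX i) (fX (i+1) * fX i * fX (i+1))
  | XE_far {i j : ℕ} (h1 : 1 ≤ i) (h2 : i ≤ P.n - 1) (h3 : 1 ≤ j) (h4 : j ≤ P.n - 1)
      (h : i + 2 ≤ j ∨ j + 2 ≤ i) : Rel P (fX i * fE j) (fE j * fX i)
  | EE_far {i j : ℕ} (h1 : 1 ≤ i) (h2 : i ≤ P.n - 1) (h3 : 1 ≤ j) (h4 : j ≤ P.n - 1)
      (h : i + 2 ≤ j ∨ j + 2 ≤ i) : Rel P (fE i * fE j) (fE j * fE i)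
  | untwist_right {i : ℕ} (h1 : 1 ≤ i) (h2 : i ≤ P.n - 1) :
      Rel P (fX i * fE i) ((P.lam : R) • fE i)
  | untwist_left {i : ℕ} (h1 : 1 ≤ i) (h2 : i ≤ P.n - 1) :
      Rel P (fE i * fX i) ((P.lam : R) • fE i)
  | XXE {i j : ℕ} (h1 : 1 ≤ i) (h2 : i ≤ P.n - 1) (h3 : 1 ≤ j) (h4 : j ≤ P.n - 1)
      (h : j = i + 1 ∨ i = j + 1) : Rel P (fX i * fX j * fE i) (fE j * fE i)
  | EXX {i j : ℕ} (h1 : 1 ≤ i) (h2 : i ≤ P.n - 1) (h3 : 1 ≤ j) (h4 : j ≤ P.n - 1)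
      (h : j = i + 1 ∨ i = j + 1) : Rel P (fE j * fE i) (fE j * fX i * fX j)
  | EEE_up {i : ℕ} (h1 : 1 ≤ i) (h2 : i + 1 ≤ P.n - 1) :
      Rel P (fE i * fE (i+1) * fE i) (fE i)
  | EEE_down {i : ℕ} (h1 : 1 ≤ i) (h2 : i + 1 ≤ P.n - 1) :
      Rel P (fE (i+1) * fE i * fE (i+1)) (fE (i+1))
  | E_sq {i : ℕ} (h1 : 1 ≤ i) (h2 : i ≤ P.n - 1) : Rel P (fE i * fE i) (P.A 0 • fE i)
  | cyclo : Rel P (fY ^ P.k) (∑ i ∈ Finset.range P.k, P.qc i • fY ^ i)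
  | braidB (h : 2 ≤ P.n) :
      Rel P (fX 1 * fY * fX 1 * fY) (fY * fX 1 * fY * fX 1)
  | YX_comm {i : ℕ} (h1 : 2 ≤ i) (h2 : i ≤ P.n - 1) : Rel P (fY * fX i) (fX i * fY)
  | YE_comm {i : ℕ} (h1 : 2 ≤ i) (h2 : i ≤ P.n - 1) : Rel P (fY * fE i) (fE i * fY)
  | YXYE (h : 2 ≤ P.n) : Rel P (fY * fX 1 * fY * fE 1) (P.laminv • fE 1)
  | EYXY (h : 2 ≤ P.n) : Rel P (fE 1 * (fY * fX 1 * fY)) (P.laminv • fE 1)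
  | EYE {m : ℕ} (h : 2 ≤ P.n) (hm : m ≤ P.k - 1) :
      Rel P (fE 1 * fY ^ m * fE 1) (P.A m • fE 1)

/-- The cyclotomic BMW algebra `B_n^k(R)`. -/
abbrev Alg (P : Params R) := RingQuot (Rel P)

def pr (P : Params R) : F R →ₐ[R] Alg P := RingQuot.mkAlgHom R (Rel P)

/-- The generator `Y`. -/
def Yg (P : Params R) : Alg P := pr P fY
/-- The generator `Y⁻¹`. -/
def Ygi (P : Params R) : Alg P := pr P fYi
/-- The generator `Xᵢ`. -/
def Xg (P : Params R) (i : ℕ) : Alg P := pr P (fX i)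
/-- The generator `Xᵢ⁻¹`. -/
def Xgi (P : Params R) (i : ℕ) : Alg P := pr P (fXi i)
/-- The generator `eᵢ`. -/
def Eg (P : Params R) (i : ℕ) : Alg P := pr P (fE i)

/-- `X₁ X₂ ⋯ X_m`. -/
def upX (P : Params R) : ℕ → Alg P
  | 0 => 1
  | m + 1 => upX P m * Xg P (m + 1)

/-- `X_m ⋯ X₂ X₁`. -/
def downX (P : Params R) : ℕ → Alg P
  | 0 => 1
  | m + 1 => Xg P (m + 1) * downX P m

/-- `X₁⁻¹ X₂⁻¹ ⋯ X_m⁻¹`. -/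
def upXi (P : Params R) : ℕ → Alg P
  | 0 => 1
  | m + 1 => upXi P m * Xgi P (m + 1)

/-- `X_m⁻¹ ⋯ X₂⁻¹ X₁⁻¹`. -/
def downXi (P : Params R) : ℕ → Alg P
  | 0 => 1
  | m + 1 => Xgi P (m + 1) * downXi P m

/-- `Yᵢ' = X_{i-1} ⋯ X₁ Y X₁ ⋯ X_{i-1}`. -/
def Yp (P : Params R) (i : ℕ) : Alg P := downX P (i - 1) * Yg P * upX P (i - 1)

/-- `(Yᵢ')⁻¹ = X_{i-1}⁻¹ ⋯ X₁⁻¹ Y⁻¹ X₁⁻¹ ⋯ X_{i-1}⁻¹`. -/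
def YpInv (P : Params R) (i : ℕ) : Alg P := downXi P (i - 1) * Ygi P * upXi P (i - 1)

/-- `(Yᵢ')^p` for an integer exponent `p`. -/
def Ypow (P : Params R) (i : ℕ) (p : ℤ) : Alg P :=
  if 0 ≤ p then Yp P i ^ p.toNat else YpInv P i ^ (-p).toNat

/-- `Y^{s 1} (Y₂')^{s 2} ⋯ (Y_m')^{s m}`. -/
def YpowProd (P : Params R) (s : ℕ → ℤ) : ℕ → Alg P
  | 0 => 1
  | m + 1 => YpowProd P s m * Ypow P (m + 1) (s (m + 1))

/-- The subalgebra `B_l` generated by `Y^{±1}, X₁^{±1}, …, X_{l-1}^{±1}, e₁, …, e_{l-1}`. -/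
def Bsub (P : Params R) (l : ℕ) : Subalgebra R (Alg P) :=
  Algebra.adjoin R
    ({Yg P, Ygi P} ∪
      {x | ∃ i, 1 ≤ i ∧ i + 1 ≤ l ∧ (x = Xg P i ∨ x = Xgi P i ∨ x = Eg P i)})

/-- `α_{ijl}^p = (Yᵢ')^p Xᵢ ⋯ X_{j-1} e_j ⋯ e_l`. -/
def alpha (P : Params R) (i j l : ℕ) (p : ℤ) : Alg P :=
  Ypow P i p * ((List.range' i (j - i)).map fun t => Xg P t).prod *
    ((List.range' j (l + 1 - j)).map fun t => Eg P t).prod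

/-- The set `P = {⌊k/2⌋ - (k-1), …, ⌊k/2⌋}` of `k` consecutive integers. -/
def Pset (k : ℕ) : Set ℤ := {p | (↑(k / 2) : ℤ) - ((k : ℤ) - 1) ≤ p ∧ p ≤ (↑(k / 2) : ℤ)}

/-- `α_{i₁,j₁,l-1}^{s₁} ⋯ α_{i_m,j_m,l-2m+1}^{s_m}`. -/
def alphaChain (P : Params R) (l : ℕ) (ii jj : ℕ → ℕ) (ss : ℕ → ℤ) : ℕ → Alg P
  | 0 => 1
  | m + 1 => alphaChain P l ii jj ss m *
      alpha P (ii (m + 1)) (jj (m + 1)) (l + 1 - 2 * (m + 1)) (ss (m + 1))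

/-- `α_{i₁,j₁,l-2}^{s₁} ⋯ α_{i_m,j_m,l-2m}^{s_m}`. -/
def alphaChainBar (P : Params R) (l : ℕ) (ii jj : ℕ → ℕ) (ss : ℕ → ℤ) : ℕ → Alg P
  | 0 => 1
  | m + 1 => alphaChainBar P l ii jj ss m *
      alpha P (ii (m + 1)) (jj (m + 1)) (l - 2 * (m + 1)) (ss (m + 1))

/-- `E_{l,m} = e_{l-1} e_{l-3} ⋯ e_{l-2m+1}`. -/
def Echain (P : Params R) (l : ℕ) : ℕ → Alg P
  | 0 => 1
  | m + 1 => Echain P l m * Eg P (l + 1 - 2 * (m + 1))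

/-- The set `V_{l,m}^g`. -/
def Vg (P : Params R) (l m : ℕ) : Set (Alg P) :=
  {x | ∃ ii jj : ℕ → ℕ, ∃ ss : ℕ → ℤ,
    (∀ t, 1 ≤ t → t ≤ m →
      1 ≤ ii t ∧ ii t ≤ jj t ∧ jj t ≤ l + 1 - 2 * t ∧ ss t ∈ Pset P.k) ∧
    x = alphaChain P l ii jj ss m}

/-- The set `V_{l,m}`. -/
def V (P : Params R) (l m : ℕ) : Set (Alg P) :=
  {x | ∃ ii jj : ℕ → ℕ, ∃ ss : ℕ → ℤ,
    (∀ t, 1 ≤ t → t ≤ m →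
      1 ≤ ii t ∧ ii t ≤ jj t ∧ jj t ≤ l + 1 - 2 * t ∧ ss t ∈ Pset P.k) ∧
    (∀ t, 1 ≤ t → t + 1 ≤ m → ii (t + 1) < ii t) ∧
    x = alphaChain P l ii jj ss m}

/-- The set `V̄_{l,m}`. -/
def Vbar (P : Params R) (l m : ℕ) : Set (Alg P) :=
  {x | ∃ ii jj : ℕ → ℕ, ∃ ss : ℕ → ℤ,
    (∀ t, 1 ≤ t → t ≤ m →
      1 ≤ ii t ∧ ii t ≤ jj t ∧ jj t ≤ l + 1 - 2 * t ∧ ss t ∈ Pset P.k) ∧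
    (∀ t, 1 ≤ t → t + 1 ≤ m → ii (t + 1) < ii t) ∧
    x = alphaChainBar P l ii jj ss m}

end CBMW

open CBMW

namespace CBMW

variable {R : Type} [CommRing R] {P : Params R}

/-! ### Defining relations -/

theorem pr_eq {a b : F R} (h : Rel P a b) : pr P a = pr P b := RingQuot.mkAlgHom_rel R h

theorem mul_assoc_of_eq {M : Type*} [Semigroup M] {a b c : M} (h : a * b = c) (x : M) :
    a * (b * x) = c * x := by rw [← mul_assoc, h]

theorem X_mul_Xi (i : ℕ) : Xg P i * Xgi P i = 1 := by
  by_cases h : 1 ≤ i ∧ i ≤ P.n - 1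
  · simpa [Xg, Xgi] using pr_eq (Rel.X_inv_right (P := P) h.1 h.2)
  · have h' : i = 0 ∨ P.n - 1 < i := by omega
    have h1 := pr_eq (Rel.X_invalid (P := P) h')
    have h2 := pr_eq (Rel.Xi_invalid (P := P) h')
    simp [Xg, Xgi, h1, h2]

theorem Xi_mul_X (i : ℕ) : Xgi P i * Xg P i = 1 := by
  by_cases h : 1 ≤ i ∧ i ≤ P.n - 1
  · simpa [Xg, Xgi] using pr_eq (Rel.X_inv_left (P := P) h.1 h.2)
  · have h' : i = 0 ∨ P.n - 1 < i := by omega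
    have h1 := pr_eq (Rel.X_invalid (P := P) h')
    have h2 := pr_eq (Rel.Xi_invalid (P := P) h')
    simp [Xg, Xgi, h1, h2]

theorem X_mul_Xi_mul (i : ℕ) (x : Alg P) : Xg P i * (Xgi P i * x) = x := by
  rw [← mul_assoc, X_mul_Xi, one_mul]

theorem Xi_mul_X_mul (i : ℕ) (x : Alg P) : Xgi P i * (Xg P i * x) = x := by
  rw [← mul_assoc, Xi_mul_X, one_mul]

theorem X_of_invalid {i : ℕ} (h : i = 0 ∨ P.n - 1 < i) : Xg P i = 1 := by
  simpa [Xg] using pr_eq (Rel.X_invalid (P := P) h)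

theorem E_of_invalid {i : ℕ} (h : i = 0 ∨ P.n - 1 < i) : Eg P i = 0 := by
  simpa [Eg] using pr_eq (Rel.E_invalid (P := P) h)

theorem Y_mul_Yi : Yg P * Ygi P = 1 := by
  simpa [Yg, Ygi] using pr_eq (Rel.Y_inv_right (P := P))

theorem Yi_mul_Y : Ygi P * Yg P = 1 := by
  simpa [Yg, Ygi] using pr_eq (Rel.Y_inv_left (P := P))

theorem Xi_eq {i : ℕ} (h1 : 1 ≤ i) (h2 : i < P.n) :
    Xgi P i = Xg P i - P.delta • (1 - Eg P i) := by
  have h : Xg P i - Xgi P i = P.delta • (1 - Eg P i) := by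
    simpa [Xg, Xgi, Eg] using pr_eq (Rel.skein (P := P) h1 (show i ≤ P.n - 1 by omega))
  rw [← h]; abel

theorem XX_far {i j : ℕ} (h : i + 2 ≤ j ∨ j + 2 ≤ i) : Commute (Xg P i) (Xg P j) := by
  by_cases hi : i = 0 ∨ P.n - 1 < i
  · rw [X_of_invalid hi]; exact Commute.one_left _
  by_cases hj : j = 0 ∨ P.n - 1 < j
  · rw [X_of_invalid hj]; exact Commute.one_right _
  have := pr_eq (Rel.XX_far (P := P) (i := i) (j := j) (by omega) (by omega) (by omega)
    (by omega) h)
  rwa [map_mul, map_mul] at this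

theorem XE_far {i j : ℕ} (h : i + 2 ≤ j ∨ j + 2 ≤ i) : Commute (Xg P i) (Eg P j) := by
  by_cases hi : i = 0 ∨ P.n - 1 < i
  · rw [X_of_invalid hi]; exact Commute.one_left _
  by_cases hj : j = 0 ∨ P.n - 1 < j
  · rw [E_of_invalid hj]; exact Commute.zero_right _
  have := pr_eq (Rel.XE_far (P := P) (i := i) (j := j) (by omega) (by omega) (by omega)
    (by omega) h)
  rwa [map_mul, map_mul] at this

theorem EE_far {i j : ℕ} (h : i + 2 ≤ j ∨ j + 2 ≤ i) : Commute (Eg P i) (Eg P j) := by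
  by_cases hi : i = 0 ∨ P.n - 1 < i
  · rw [E_of_invalid hi]; exact Commute.zero_left _
  by_cases hj : j = 0 ∨ P.n - 1 < j
  · rw [E_of_invalid hj]; exact Commute.zero_right _
  have := pr_eq (Rel.EE_far (P := P) (i := i) (j := j) (by omega) (by omega) (by omega)
    (by omega) h)
  rwa [map_mul, map_mul] at this

theorem commute_Xi_right {x : Alg P} {i : ℕ} (h : Commute x (Xg P i)) :
    Commute x (Xgi P i) := by
  have h' : x * Xg P i = Xg P i * x := h
  change x * Xgi P i = Xgi P i * x
  calc x * Xgi P i = Xgi P i * (Xg P i * x) * Xgi P i := by rw [Xi_mul_X_mul]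
    _ = Xgi P i * x := by rw [← h', mul_assoc, mul_assoc, X_mul_Xi, mul_one]

theorem commute_Yi_right {x : Alg P} (h : Commute x (Yg P)) : Commute x (Ygi P) := by
  have h' : x * Yg P = Yg P * x := h
  change x * Ygi P = Ygi P * x
  calc x * Ygi P = Ygi P * (Yg P * x) * Ygi P := by rw [← mul_assoc (Ygi P), Yi_mul_Y, one_mul]
    _ = Ygi P * x := by rw [← h', mul_assoc, mul_assoc, Y_mul_Yi, mul_one]

theorem YX_comm {i : ℕ} (h : 2 ≤ i) : Commute (Yg P) (Xg P i) := by
  by_cases hi : P.n - 1 < i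
  · rw [X_of_invalid (Or.inr hi)]; exact Commute.one_right _
  have := pr_eq (Rel.YX_comm (P := P) h (by omega))
  rwa [map_mul, map_mul] at this

theorem YE_comm {i : ℕ} (h : 2 ≤ i) : Commute (Yg P) (Eg P i) := by
  by_cases hi : P.n - 1 < i
  · rw [E_of_invalid (Or.inr hi)]; exact Commute.zero_right _
  have := pr_eq (Rel.YE_comm (P := P) h (by omega))
  rwa [map_mul, map_mul] at this

theorem braid {i : ℕ} (h1 : 1 ≤ i) (h2 : i + 1 < P.n) :
    Xg P i * (Xg P (i + 1) * Xg P i) = Xg P (i + 1) * (Xg P i * Xg P (i + 1)) := by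
  simpa [Xg, mul_assoc] using pr_eq (Rel.braid (P := P) h1 (show i + 1 ≤ P.n - 1 by omega))

theorem X_mul_E (i : ℕ) : Xg P i * Eg P i = (P.lam : R) • Eg P i := by
  by_cases hi : i = 0 ∨ P.n - 1 < i
  · simp [E_of_invalid hi]
  simpa [Xg, Eg] using pr_eq (Rel.untwist_right (P := P) (i := i) (by omega) (by omega))

theorem E_mul_X (i : ℕ) : Eg P i * Xg P i = (P.lam : R) • Eg P i := by
  by_cases hi : i = 0 ∨ P.n - 1 < i
  · simp [E_of_invalid hi]
  simpa [Xg, Eg] using pr_eq (Rel.untwist_left (P := P) (i := i) (by omega) (by omega))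

theorem laminv_mul_lam : P.laminv * (P.lam : R) = 1 := by simp [Params.laminv]

theorem lam_mul_laminv : (P.lam : R) * P.laminv = 1 := by simp [Params.laminv]

theorem Xi_mul_E (i : ℕ) : Xgi P i * Eg P i = P.laminv • Eg P i := by
  have h := congrArg (fun x => P.laminv • (Xgi P i * x)) (X_mul_E (P := P) i)
  simp only [mul_smul_comm, smul_smul, laminv_mul_lam, one_smul, Xi_mul_X_mul] at h
  exact h.symm

theorem E_mul_Xi (i : ℕ) : Eg P i * Xgi P i = P.laminv • Eg P i := by
  have h := congrArg (fun x => P.laminv • (x * Xgi P i)) (E_mul_X (P := P) i)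
  simp only [smul_mul_assoc, smul_smul, laminv_mul_lam, one_smul, mul_assoc, X_mul_Xi,
    mul_one] at h
  exact h.symm

theorem X_X_E {i j : ℕ} (hi : 1 ≤ i) (hi' : i < P.n) (hj : 1 ≤ j) (hj' : j < P.n)
    (h : j = i + 1 ∨ i = j + 1) : Xg P i * (Xg P j * Eg P i) = Eg P j * Eg P i := by
  simpa [Xg, Eg, mul_assoc] using
    pr_eq (Rel.XXE (P := P) hi (show i ≤ P.n - 1 by omega) hj (by omega) h)

theorem E_X_X {i j : ℕ} (hi : 1 ≤ i) (hi' : i < P.n) (hj : 1 ≤ j) (hj' : j < P.n)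
    (h : j = i + 1 ∨ i = j + 1) : Eg P j * (Xg P i * Xg P j) = Eg P j * Eg P i := by
  simpa [Xg, Eg, mul_assoc] using
    (pr_eq (Rel.EXX (P := P) hi (show i ≤ P.n - 1 by omega) hj (by omega) h)).symm

theorem E_E_E {i j : ℕ} (hi : 1 ≤ i) (hi' : i < P.n) (hj : 1 ≤ j) (hj' : j < P.n)
    (h : j = i + 1 ∨ i = j + 1) : Eg P i * (Eg P j * Eg P i) = Eg P i := by
  rcases h with rfl | rfl
  · simpa [Eg, mul_assoc] using pr_eq (Rel.EEE_up (P := P) hi (show i + 1 ≤ P.n - 1 by omega))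
  · simpa [Eg, mul_assoc] using
      pr_eq (Rel.EEE_down (P := P) hj (show j + 1 ≤ P.n - 1 by omega))

/-! ### The elements `Yᵢ'` -/

theorem upX_mul_downXi (m : ℕ) : upX P m * downXi P m = 1 := by
  induction m with
  | zero => simp [upX, downXi]
  | succ m ih => rw [upX, downXi, mul_assoc, X_mul_Xi_mul, ih]

theorem downXi_mul_upX (m : ℕ) : downXi P m * upX P m = 1 := by
  induction m with
  | zero => simp [upX, downXi]
  | succ m ih =>
    rw [upX, downXi, mul_assoc, ← mul_assoc (downXi P m), ih, one_mul, Xi_mul_X]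

theorem downX_mul_upXi (m : ℕ) : downX P m * upXi P m = 1 := by
  induction m with
  | zero => simp [downX, upXi]
  | succ m ih =>
    rw [downX, upXi, mul_assoc, ← mul_assoc (downX P m), ih, one_mul, X_mul_Xi]

theorem upXi_mul_downX (m : ℕ) : upXi P m * downX P m = 1 := by
  induction m with
  | zero => simp [downX, upXi]
  | succ m ih => rw [downX, upXi, mul_assoc, Xi_mul_X_mul, ih]

/-- `Yᵢ'` as a unit. -/
def Zu (P : Params R) (i : ℕ) : (Alg P)ˣ where
  val := Yp P i
  inv := YpInv P i
  val_inv := by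
    simp only [Yp, YpInv, mul_assoc]
    rw [← mul_assoc (upX P _), upX_mul_downXi, one_mul, mul_assoc_of_eq Y_mul_Yi, one_mul,
      downX_mul_upXi]
  inv_val := by
    simp only [Yp, YpInv, mul_assoc]
    rw [← mul_assoc (upXi P _), upXi_mul_downX, one_mul, mul_assoc_of_eq Yi_mul_Y, one_mul,
      downXi_mul_upX]

/-- Integer powers of `Yᵢ'`. -/
def Zp (P : Params R) (i : ℕ) (s : ℤ) : Alg P := ((Zu P i ^ s : (Alg P)ˣ) : Alg P)

theorem Ypow_eq (i : ℕ) (s : ℤ) : Ypow P i s = Zp P i s := by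
  unfold Ypow Zp
  split_ifs with h
  · obtain ⟨m, rfl⟩ := Int.eq_ofNat_of_zero_le h
    simp [Zu]
  · obtain ⟨m, hm⟩ := Int.eq_ofNat_of_zero_le (show 0 ≤ -s by omega)
    obtain rfl : s = -(m : ℤ) := by omega
    simp [Zu, ← inv_pow, Units.inv_mk]

@[simp] theorem Zp_zero (i : ℕ) : Zp P i 0 = 1 := by simp [Zp]

theorem Zp_one (i : ℕ) : Zp P i 1 = Yp P i := by simp [Zp, Zu]

theorem Zp_add (i : ℕ) (a b : ℤ) : Zp P i (a + b) = Zp P i a * Zp P i b := by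
  simp [Zp, zpow_add]

theorem Zp_mul_Zp (i : ℕ) (a b : ℤ) : Zp P i a * Zp P i b = Zp P i (a + b) :=
  (Zp_add i a b).symm

theorem Zp_mul_Zp_mul (i : ℕ) (a b : ℤ) (x : Alg P) :
    Zp P i a * (Zp P i b * x) = Zp P i (a + b) * x := by rw [Zp_add, mul_assoc]

theorem commute_Zp {x : Alg P} {i : ℕ} (h : Commute x (Yp P i)) (s : ℤ) :
    Commute x (Zp P i s) :=
  Commute.units_zpow_right (u := Zu P i) h s

theorem Yp_one : Yp P 1 = Yg P := by simp [Yp, downX, upX]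

theorem Yp_succ {i : ℕ} (h : 1 ≤ i) : Yp P (i + 1) = Xg P i * (Yp P i * Xg P i) := by
  obtain ⟨m, rfl⟩ := Nat.exists_eq_add_of_le' h
  simp only [Yp, Nat.add_sub_cancel, downX, upX, mul_assoc]

theorem X_commute_Yp_of_lt {i t : ℕ} (hi : 1 ≤ i) (h : i + 1 ≤ t) :
    Commute (Xg P t) (Yp P i) := by
  induction i, hi using Nat.le_induction with
  | base => rw [Yp_one]; exact (YX_comm h).symm
  | succ i hi ih =>
    rw [Yp_succ hi]
    exact (XX_far (by omega)).mul_right ((ih (by omega)).mul_right (XX_far (by omega)))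

theorem E_commute_Yp_of_lt {i t : ℕ} (hi : 1 ≤ i) (h : i + 1 ≤ t) :
    Commute (Eg P t) (Yp P i) := by
  induction i, hi using Nat.le_induction with
  | base => rw [Yp_one]; exact (YE_comm h).symm
  | succ i hi ih =>
    rw [Yp_succ hi]
    exact (XE_far (by omega)).symm.mul_right
      ((ih (by omega)).mul_right (XE_far (by omega)).symm)

theorem X_commute_Yp_of_gt {i t : ℕ} (ht : 1 ≤ t) (h : t + 2 ≤ i) (hn : i ≤ P.n) :
    Commute (Xg P t) (Yp P i) := by
  induction i, h using Nat.le_induction with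
  | base =>
    have hb := braid (P := P) ht (by omega)
    have hc : Xg P (t + 1) * Yp P t = Yp P t * Xg P (t + 1) :=
      X_commute_Yp_of_lt ht le_rfl
    rw [Yp_succ (by omega), Yp_succ ht, commute_iff_eq]
    have h1 : Xg P t * (Xg P (t + 1) * (Xg P t * (Yp P t * Xg P t) * Xg P (t + 1)))
        = (Xg P t * (Xg P (t + 1) * Xg P t)) * Yp P t * (Xg P t * Xg P (t + 1)) := by
      simp only [mul_assoc]
    have h2 : Xg P (t + 1) * (Xg P t * (Yp P t * Xg P t) * Xg P (t + 1)) * Xg P t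
        = Xg P (t + 1) * Xg P t * Yp P t * (Xg P t * (Xg P (t + 1) * Xg P t)) := by
      simp only [mul_assoc]
    rw [h1, h2, hb]
    simp only [mul_assoc, mul_assoc_of_eq hc]
  | succ i hi ih =>
    rw [Yp_succ (by omega)]
    exact (XX_far (by omega)).mul_right ((ih (by omega)).mul_right (XX_far (by omega)))

theorem E_commute_Yp_of_gt {i t : ℕ} (ht : 1 ≤ t) (h : t + 2 ≤ i) (hn : i ≤ P.n) :
    Commute (Eg P t) (Yp P i) := by
  induction i, h using Nat.le_induction with
  | base =>
    have hc : Eg P (t + 1) * Yp P t = Yp P t * Eg P (t + 1) :=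
      E_commute_Yp_of_lt ht le_rfl
    have e1 : Eg P t * (Xg P (t + 1) * Xg P t) = Xg P (t + 1) * (Xg P t * Eg P (t + 1)) := by
      rw [E_X_X (by omega) (by omega) ht (by omega) (by omega),
        X_X_E (by omega) (by omega) ht (by omega) (by omega)]
    have e2 : Eg P (t + 1) * (Xg P t * Xg P (t + 1)) = Xg P t * (Xg P (t + 1) * Eg P t) := by
      rw [E_X_X ht (by omega) (by omega) (by omega) (by omega),
        X_X_E ht (by omega) (by omega) (by omega) (by omega)]
    rw [Yp_succ (by omega), Yp_succ ht, commute_iff_eq]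
    have h1 : Eg P t * (Xg P (t + 1) * (Xg P t * (Yp P t * Xg P t) * Xg P (t + 1)))
        = (Eg P t * (Xg P (t + 1) * Xg P t)) * Yp P t * (Xg P t * Xg P (t + 1)) := by
      simp only [mul_assoc]
    have h2 : Xg P (t + 1) * (Xg P t * (Yp P t * Xg P t) * Xg P (t + 1)) * Eg P t
        = Xg P (t + 1) * Xg P t * Yp P t * (Xg P t * (Xg P (t + 1) * Eg P t)) := by
      simp only [mul_assoc]
    rw [h1, h2, e1, ← e2]
    simp only [mul_assoc, mul_assoc_of_eq hc]
  | succ i hi ih =>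
    rw [Yp_succ (by omega)]
    exact (XE_far (by omega)).symm.mul_right
      ((ih (by omega)).mul_right (XE_far (by omega)).symm)

theorem Y_commute_Yp {i : ℕ} (h : 1 ≤ i) : Commute (Yg P) (Yp P i) := by
  induction i, h using Nat.le_induction with
  | base => rw [Yp_one]
  | succ i hi ih =>
    rw [Yp_succ hi]
    by_cases h1 : i = 1
    · subst h1
      rw [Yp_one]
      by_cases hn : 2 ≤ P.n
      · have := pr_eq (Rel.braidB (P := P) hn)
        simp only [map_mul] at this
        rw [commute_iff_eq]
        simpa only [Xg, Yg, mul_assoc] using this.symm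
      · rw [X_of_invalid (Or.inr (by omega))]; simp
    · exact (YX_comm (by omega)).mul_right (ih.mul_right (YX_comm (by omega)))

/-! ### Commutation with subalgebras -/

theorem commute_of_mem_adjoin {s : Set (Alg P)} {x y : Alg P} (h : ∀ g ∈ s, Commute x g)
    (hy : y ∈ Algebra.adjoin R s) : Commute x y := by
  have : Algebra.adjoin R s ≤ Subalgebra.centralizer R {x} :=
    Algebra.adjoin_le fun g hg => by
      rw [SetLike.mem_coe, Subalgebra.mem_centralizer_iff]
      rintro _ rfl
      exact h g hg
  exact (Subalgebra.mem_centralizer_iff R).1 (this hy) x rfl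

theorem commute_of_mem_Bsub {l : ℕ} {x y : Alg P} (hY : Commute x (Yg P))
    (hX : ∀ t, 1 ≤ t → t + 1 ≤ l → Commute x (Xg P t))
    (hE : ∀ t, 1 ≤ t → t + 1 ≤ l → Commute x (Eg P t)) (hy : y ∈ Bsub P l) : Commute x y := by
  refine commute_of_mem_adjoin ?_ hy
  rintro g ((rfl | rfl) | ⟨t, h1, h2, rfl | rfl | rfl⟩)
  · exact hY
  · exact commute_Yi_right hY
  · exact hX t h1 h2
  · exact commute_Xi_right (hX t h1 h2)
  · exact hE t h1 h2

theorem Y_mem_Bsub (l : ℕ) : Yg P ∈ Bsub P l := Algebra.subset_adjoin (by simp)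
theorem Yi_mem_Bsub (l : ℕ) : Ygi P ∈ Bsub P l := Algebra.subset_adjoin (by simp)
theorem X_mem_Bsub {l t : ℕ} (h : 1 ≤ t) (h' : t + 1 ≤ l) : Xg P t ∈ Bsub P l :=
  Algebra.subset_adjoin (Or.inr ⟨t, h, h', Or.inl rfl⟩)
theorem Xi_mem_Bsub {l t : ℕ} (h : 1 ≤ t) (h' : t + 1 ≤ l) : Xgi P t ∈ Bsub P l :=
  Algebra.subset_adjoin (Or.inr ⟨t, h, h', Or.inr (Or.inl rfl)⟩)
theorem E_mem_Bsub {l t : ℕ} (h : 1 ≤ t) (h' : t + 1 ≤ l) : Eg P t ∈ Bsub P l :=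
  Algebra.subset_adjoin (Or.inr ⟨t, h, h', Or.inr (Or.inr rfl)⟩)

theorem Bsub_mono {l l' : ℕ} (h : l ≤ l') : Bsub P l ≤ Bsub P l' := by
  refine Algebra.adjoin_mono ?_
  rintro g (hg | ⟨t, h1, h2, hg⟩)
  · exact Or.inl hg
  · exact Or.inr ⟨t, h1, by omega, hg⟩

theorem Zp_mem_Bsub {i l : ℕ} (hi : 1 ≤ i) (h : i ≤ l) (s : ℤ) : Zp P i s ∈ Bsub P l := by
  have h1 : Yp P i ∈ Bsub P l := by
    induction i, hi using Nat.le_induction with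
    | base => rw [Yp_one]; exact Y_mem_Bsub l
    | succ i hi ih =>
      rw [Yp_succ hi]
      exact mul_mem (X_mem_Bsub hi h) (mul_mem (ih (by omega)) (X_mem_Bsub hi h))
  have h2 : YpInv P i ∈ Bsub P l := by
    clear h1
    obtain ⟨m, rfl⟩ := Nat.exists_eq_add_of_le' hi
    rw [YpInv, Nat.add_sub_cancel]
    clear hi
    induction m with
    | zero => simpa [downXi, upXi] using Yi_mem_Bsub l
    | succ m ih =>
      have : downXi P (m + 1) * Ygi P * upXi P (m + 1)
          = Xgi P (m + 1) * ((downXi P m * Ygi P * upXi P m) * Xgi P (m + 1)) := by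
        simp only [downXi, upXi, mul_assoc]
      rw [this]
      exact mul_mem (Xi_mem_Bsub (by omega) h)
        (mul_mem (ih (by omega)) (Xi_mem_Bsub (by omega) h))
  rw [← Ypow_eq, Ypow]
  split_ifs
  exacts [pow_mem h1 _, pow_mem h2 _]

/-- The subalgebra generated by the elements that live strictly to the left of strand `i`. -/
def Low (P : Params R) (i : ℕ) : Subalgebra R (Alg P) := if i ≤ 1 then ⊥ else Bsub P (i - 1)

theorem commute_of_mem_Low {i : ℕ} {x y : Alg P} (hY : 2 ≤ i → Commute x (Yg P))
    (hX : ∀ t, 1 ≤ t → t + 2 ≤ i → Commute x (Xg P t))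
    (hE : ∀ t, 1 ≤ t → t + 2 ≤ i → Commute x (Eg P t)) (hy : y ∈ Low P i) : Commute x y := by
  unfold Low at hy
  split_ifs at hy with h
  · obtain ⟨c, rfl⟩ := Algebra.mem_bot.1 hy
    exact (Algebra.commutes c x).symm
  · exact commute_of_mem_Bsub (hY (by omega)) (fun t h1 h2 => hX t h1 (by omega))
      (fun t h1 h2 => hE t h1 (by omega)) hy

theorem Low_le_Bsub {i l : ℕ} (h : i ≤ l + 1) : Low P i ≤ Bsub P l := by
  unfold Low
  split_ifs with h1
  · exact bot_le
  · exact Bsub_mono (by omega)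

theorem Bsub_le_Low {i l : ℕ} (h : l < i) (hi : 2 ≤ i) : Bsub P l ≤ Low P i := by
  unfold Low
  rw [if_neg (by omega)]
  exact Bsub_mono (by omega)

theorem Low_mono {i i' : ℕ} (h : i ≤ i') : Low P i ≤ Low P i' := by
  by_cases h2 : 2 ≤ i
  · exact (Low_le_Bsub (l := i - 1) (by omega)).trans (Bsub_le_Low (by omega) (by omega))
  · rw [Low, if_pos (by omega)]; exact bot_le

theorem Zp_mem_Low {i j : ℕ} (hj : 1 ≤ j) (h : j < i) (s : ℤ) : Zp P j s ∈ Low P i :=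
  Bsub_le_Low h (by omega) (Zp_mem_Bsub hj le_rfl s)

theorem Zp_commute_Bsub {l t : ℕ} {y : Alg P} (hy : y ∈ Bsub P l) (h : l < t) (hn : t ≤ P.n)
    (s : ℤ) : Commute (Zp P t s) y :=
  commute_of_mem_Bsub (commute_Zp (Y_commute_Yp (by omega)) s).symm
    (fun _ h1 _ => (commute_Zp (X_commute_Yp_of_gt h1 (by omega) hn) s).symm)
    (fun _ h1 _ => (commute_Zp (E_commute_Yp_of_gt h1 (by omega) hn) s).symm) hy

theorem Zp_commute_Low {i t : ℕ} {y : Alg P} (hy : y ∈ Low P i) (ht : 1 ≤ t) (h : i ≤ t)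
    (hn : t ≤ P.n) (s : ℤ) : Commute (Zp P t s) y :=
  Zp_commute_Bsub (Low_le_Bsub (l := t - 1) (by omega) hy) (by omega) hn s

theorem X_commute_Low {i t : ℕ} {y : Alg P} (hy : y ∈ Low P i) (h : i ≤ t) :
    Commute (Xg P t) y :=
  commute_of_mem_Low (fun h2 => (YX_comm (by omega)).symm) (fun _ _ _ => XX_far (by omega))
    (fun _ _ _ => XE_far (by omega)) hy

theorem E_commute_Low {i t : ℕ} {y : Alg P} (hy : y ∈ Low P i) (h : i ≤ t) :
    Commute (Eg P t) y :=
  commute_of_mem_Low (fun h2 => (YE_comm (by omega)).symm)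
    (fun _ _ _ => (XE_far (by omega)).symm) (fun _ _ _ => EE_far (by omega)) hy

theorem Zp_commute_Zp {i j : ℕ} (hi : 1 ≤ i) (hi' : i ≤ P.n) (hj : 1 ≤ j) (hj' : j ≤ P.n)
    (a b : ℤ) : Commute (Zp P i a) (Zp P j b) := by
  rcases lt_trichotomy i j with h | rfl | h
  · exact (Zp_commute_Low (Zp_mem_Low hi h a) hj le_rfl hj' b).symm
  · rw [commute_iff_eq, Zp_mul_Zp, Zp_mul_Zp, add_comm]
  · exact Zp_commute_Low (Zp_mem_Low hj h b) hi le_rfl hi' a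

theorem X_commute_Zp_of_lt {i t : ℕ} (hi : 1 ≤ i) (h : i + 1 ≤ t) (s : ℤ) :
    Commute (Xg P t) (Zp P i s) := commute_Zp (X_commute_Yp_of_lt hi h) s

theorem E_commute_Zp_of_lt {i t : ℕ} (hi : 1 ≤ i) (h : i + 1 ≤ t) (s : ℤ) :
    Commute (Eg P t) (Zp P i s) := commute_Zp (E_commute_Yp_of_lt hi h) s

theorem E_commute_Zp_of_gt {i t : ℕ} (ht : 1 ≤ t) (h : t + 2 ≤ i) (hn : i ≤ P.n) (s : ℤ) :
    Commute (Eg P t) (Zp P i s) := commute_Zp (E_commute_Yp_of_gt ht h hn) s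

theorem lam_smul_laminv_smul (x : Alg P) :
    (P.lam : R) • P.laminv • x = x := by rw [smul_smul, lam_mul_laminv, one_smul]

theorem X_E_adj {i j : ℕ} (hi : 1 ≤ i) (hi' : i < P.n) (hj : 1 ≤ j) (hj' : j < P.n)
    (h : j = i + 1 ∨ i = j + 1) : Xg P j * Eg P i = Xgi P i * (Eg P j * Eg P i) := by
  rw [← X_X_E hi hi' hj hj' h, Xi_mul_X_mul]

theorem E_X_adj {i j : ℕ} (hi : 1 ≤ i) (hi' : i < P.n) (hj : 1 ≤ j) (hj' : j < P.n)
    (h : j = i + 1 ∨ i = j + 1) : Eg P j * Xg P i = Eg P j * (Eg P i * Xgi P j) := by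
  rw [← mul_assoc, ← E_X_X hi hi' hj hj' h, mul_assoc, mul_assoc, X_mul_Xi, mul_one]

theorem Yp_Yp_E {i : ℕ} (hi : 1 ≤ i) (hn : i < P.n) :
    Yp P i * (Yp P (i + 1) * Eg P i) = Eg P i ∧ Eg P i * (Yp P (i + 1) * Yp P i) = Eg P i := by
  induction i, hi using Nat.le_induction with
  | base =>
    have h1 : Yg P * (Xg P 1 * (Yg P * Eg P 1)) = P.laminv • Eg P 1 := by
      simpa [Xg, Yg, Eg, mul_assoc] using pr_eq (Rel.YXYE (P := P) (by omega))
    have h2 : Eg P 1 * (Yg P * (Xg P 1 * Yg P)) = P.laminv • Eg P 1 := by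
      simpa [Xg, Yg, Eg, mul_assoc] using pr_eq (Rel.EYXY (P := P) (by omega))
    rw [Yp_succ le_rfl, Yp_one]
    constructor
    · simp only [mul_assoc, X_mul_E, mul_smul_comm, h1]
      rw [lam_smul_laminv_smul]
    · simp only [mul_assoc, mul_assoc_of_eq (E_mul_X (P := P) 1), smul_mul_assoc, h2]
      rw [lam_smul_laminv_smul]
  | succ i hi ih =>
    obtain ⟨ih1, ih2⟩ := ih (by omega)
    rw [Yp_succ hi] at ih1 ih2
    simp only [mul_assoc, X_mul_E, mul_assoc_of_eq (E_mul_X (P := P) i), mul_smul_comm,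
      smul_mul_assoc] at ih1 ih2
    have hb : Xg P i * (Xg P (i + 1) * Xg P i) = _ := braid hi hn
    have hV : Commute (Xg P (i + 1)) (Yp P i) := X_commute_Yp_of_lt hi le_rfl
    have hVi : Commute (Yp P i) (Xgi P (i + 1)) := commute_Xi_right hV.symm
    have hf := E_E_E (P := P) (i := i + 1) (j := i) (by omega) hn hi (by omega) (by omega)
    rw [Yp_succ (i := i + 1) (by omega), Yp_succ hi]
    constructor
    · have h1 : Xg P i * (Xg P (i + 1) * Eg P (i + 1))
          = (P.lam : R) • (Xgi P (i + 1) * (Eg P i * Eg P (i + 1))) := by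
        rw [X_mul_E, mul_smul_comm,
          X_E_adj (i := i + 1) (j := i) (by omega) hn hi (by omega) (by omega)]
      have h2 : ∀ x, Xg P i * (Xg P (i + 1) * (Xg P i * (Xgi P (i + 1) * x)))
          = Xg P (i + 1) * (Xg P i * x) := by
        intro x
        have := congrArg (· * (Xgi P (i + 1) * x)) hb
        simpa only [mul_assoc, X_mul_Xi_mul] using this
      have h3 : Xg P i * (Xg P (i + 1) * Eg P i) = Eg P (i + 1) * Eg P i :=
        X_X_E hi (by omega) (by omega) hn (by omega)
      calc _ = (P.lam : R) • (Xg P i * (Yp P i * (Xg P i * (Xg P (i + 1) * (Xg P i *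
            (Xgi P (i + 1) * (Yp P i * (Eg P i * Eg P (i + 1))))))))) := by
            simp only [mul_assoc, h1, mul_smul_comm, hVi.left_comm]
        _ = Xg P i * (Xg P (i + 1) * (((P.lam : R) • (Yp P i * (Xg P i * (Yp P i * Eg P i))))
            * Eg P (i + 1))) := by
            rw [h2]
            simp only [mul_assoc, smul_mul_assoc, mul_smul_comm, hV.left_comm]
        _ = _ := by
            rw [ih1, ← mul_assoc, ← mul_assoc, mul_assoc (Xg P i), h3, mul_assoc, hf]
    · have h1 : ∀ x, Eg P (i + 1) * (Xg P (i + 1) * (Xg P i * x))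
          = (P.lam : R) • (Eg P (i + 1) * (Eg P i * (Xgi P (i + 1) * x))) := by
        intro x
        rw [mul_assoc_of_eq (E_mul_X (P := P) (i + 1)), smul_mul_assoc, mul_assoc_of_eq
          (E_X_adj (i := i) (j := i + 1) hi (by omega) (by omega) hn (by omega))]
        simp only [mul_assoc]
      have h2 : ∀ x, Xgi P (i + 1) * (Xg P i * (Xg P (i + 1) * (Xg P i * x)))
          = Xg P i * (Xg P (i + 1) * x) := by
        intro x
        have := congrArg (fun y => Xgi P (i + 1) * (y * x)) hb
        simpa only [mul_assoc, Xi_mul_X_mul] using this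
      have h3 : Eg P i * (Xg P (i + 1) * Xg P i) = Eg P i * Eg P (i + 1) :=
        E_X_X (by omega) hn hi (by omega) (by omega)
      calc _ = (P.lam : R) • (Eg P (i + 1) * (Eg P i * (Yp P i * (Xgi P (i + 1) * (Xg P i *
            (Xg P (i + 1) * (Xg P i * (Yp P i * Xg P i)))))))) := by
            simp only [mul_assoc, h1, hVi.symm.left_comm]
        _ = Eg P (i + 1) * (((P.lam : R) • (Eg P i * (Yp P i * (Xg P i * Yp P i)))) *
            (Xg P (i + 1) * Xg P i)) := by
            rw [h2]
            simp only [mul_assoc, smul_mul_assoc, mul_smul_comm, hV.left_comm]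
        _ = _ := by rw [ih2, h3, hf]

theorem Zp_succ_mul_E {i : ℕ} (hi : 1 ≤ i) (hn : i < P.n) (a : ℤ) :
    Zp P (i + 1) a * Eg P i = Zp P i (-a) * Eg P i := by
  have hc : Commute (Zu P i) (Zu P (i + 1)) := Units.ext (by
    simpa [Zp_one, Zu] using
      (Zp_commute_Zp (P := P) hi hn.le (by omega) hn 1 1 : Commute (Zp P i 1) _).eq)
  have h : Zu P i * Zu P (i + 1) ∈ MulAction.stabilizer (Alg P)ˣ (Eg P i) := by
    rw [MulAction.mem_stabilizer_iff, Units.smul_def, smul_eq_mul, Units.val_mul, mul_assoc]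
    exact (Yp_Yp_E hi hn).1
  have h' := zpow_mem h a
  rw [MulAction.mem_stabilizer_iff, Units.smul_def, smul_eq_mul, hc.mul_zpow, Units.val_mul,
    mul_assoc] at h'
  change Zp P i a * (Zp P (i + 1) a * Eg P i) = _ at h'
  conv_rhs => rw [← h']
  rw [Zp_mul_Zp_mul, neg_add_cancel, Zp_zero, one_mul]

theorem mul_units_zpow_of_mul_eq {M : Type*} [Monoid M] {e : M} {u : Mˣ} (h : e * u = e) (a : ℤ) :
    e * ((u ^ a : Mˣ) : M) = e := by
  have h1 : ∀ (w : Mˣ), e * w = e → ∀ m : ℕ, e * ((w ^ m : Mˣ) : M) = e := by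
    intro w hw m
    induction m with
    | zero => simp
    | succ m ih => rw [pow_succ, Units.val_mul, ← mul_assoc, ih, hw]
  cases a with
  | ofNat m => simpa using h1 u h m
  | negSucc m =>
    rw [zpow_negSucc, ← inv_pow]
    exact h1 _ (Units.mul_inv_eq_iff_eq_mul u |>.2 h.symm) _

theorem E_mul_Zp_succ {i : ℕ} (hi : 1 ≤ i) (hn : i < P.n) (a : ℤ) :
    Eg P i * Zp P (i + 1) a = Eg P i * Zp P i (-a) := by
  have hc : Commute (Zu P (i + 1)) (Zu P i) := Units.ext (by
    simpa [Zp_one, Zu] using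
      (Zp_commute_Zp (P := P) (by omega) hn hi hn.le 1 1 : Commute (Zp P (i + 1) 1) _).eq)
  have h : Eg P i * ((Zu P (i + 1) * Zu P i : (Alg P)ˣ) : Alg P) = Eg P i := (Yp_Yp_E hi hn).2
  have h' := mul_units_zpow_of_mul_eq h a
  rw [hc.mul_zpow, Units.val_mul] at h'
  change Eg P i * (Zp P (i + 1) a * Zp P i a) = _ at h'
  conv_rhs => rw [← h']
  rw [mul_assoc, mul_assoc, Zp_mul_Zp, add_neg_cancel, Zp_zero, mul_one]

/-! ### Moving powers of `Yᵢ'` past `Xᵢ` -/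

theorem X_mul_Zp_one {i : ℕ} (hi : 1 ≤ i) : Xg P i * Zp P i 1 = Zp P (i + 1) 1 * Xgi P i := by
  rw [Zp_one, Zp_one, Yp_succ hi]
  simp only [mul_assoc, X_mul_Xi, mul_one]

/-- The range of exponents in the expansion of `Xᵢ (Yᵢ')^p - (Yᵢ₊₁')^p Xᵢ`. -/
def Bt (p a : ℤ) : Prop := (1 ≤ a ∧ a ≤ p) ∨ (p < a ∧ a ≤ 0)

theorem pass_left_sub {i : ℕ} (hi : 1 ≤ i) (hn : i < P.n) {N : Submodule R (Alg P)}
    (v : Alg P) (p : ℤ) : ∀ (u : Alg P),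
    (∀ a, Bt p a → u * (Zp P (i + 1) a * (Zp P i (p - a) * v)) ∈ N) →
    (∀ a, Bt p a → u * (Zp P (i + 1) a * (Eg P i * (Zp P i (p - a) * v))) ∈ N) →
    u * (Xg P i * (Zp P i p * v)) - u * (Zp P (i + 1) p * (Xg P i * v)) ∈ N := by
  have key : ∀ p : ℤ, Xg P i * (Zp P i (p + 1) * v) = Zp P (i + 1) 1 * (Xg P i * (Zp P i p * v))
      - P.delta • (Zp P (i + 1) 1 * (Zp P i p * v))
      + P.delta • (Zp P (i + 1) 1 * (Eg P i * (Zp P i p * v))) := by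
    intro p
    rw [add_comm p 1, Zp_add, mul_assoc, mul_assoc_of_eq (X_mul_Zp_one hi), mul_assoc,
      Xi_eq hi hn]
    simp only [sub_mul, mul_sub, smul_mul_assoc, mul_smul_comm, one_mul, smul_sub]
    abel
  induction p using Int.induction_on with
  | zero => intro u _ _; simp
  | succ p ih =>
    intro u h1 h2
    have hp := ih (u * Zp P (i + 1) 1)
      (fun a ha => by
        have := h1 (a + 1) (by unfold Bt at *; omega)
        rw [add_sub_add_right_eq_sub, add_comm a 1, Zp_add] at this
        simpa only [mul_assoc] using this)
      (fun a ha => by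
        have := h2 (a + 1) (by unfold Bt at *; omega)
        rw [add_sub_add_right_eq_sub, add_comm a 1, Zp_add] at this
        simpa only [mul_assoc] using this)
    have q1 := h1 1 (by unfold Bt; omega)
    have q2 := h2 1 (by unfold Bt; omega)
    rw [add_sub_cancel_right] at q1 q2
    have := N.add_mem (N.sub_mem hp (N.smul_mem P.delta q1)) (N.smul_mem P.delta q2)
    rw [key, add_comm (p : ℤ) 1, Zp_add]
    convert this using 1
    simp only [mul_add, mul_sub, mul_smul_comm, mul_assoc]
    abel
  | pred p ih =>
    intro u h1 h2
    have hp := ih (u * Zp P (i + 1) (-1))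
      (fun a ha => by
        have := h1 (a - 1) (by unfold Bt at *; omega)
        rw [sub_sub_sub_cancel_right, sub_eq_neg_add a 1, Zp_add] at this
        simpa only [mul_assoc] using this)
      (fun a ha => by
        have := h2 (a - 1) (by unfold Bt at *; omega)
        rw [sub_sub_sub_cancel_right, sub_eq_neg_add a 1, Zp_add] at this
        simpa only [mul_assoc] using this)
    have q1 := h1 0 (by unfold Bt; omega)
    have q2 := h2 0 (by unfold Bt; omega)
    rw [sub_zero, Zp_zero, one_mul] at q1 q2
    have := N.sub_mem (N.add_mem hp (N.smul_mem P.delta q1)) (N.smul_mem P.delta q2)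
    convert this using 1
    have hk := key (-(p : ℤ) - 1)
    rw [sub_add_cancel] at hk
    rw [hk]
    simp only [mul_add, mul_sub, mul_smul_comm, mul_assoc, Zp_mul_Zp_mul]
    rw [neg_add_cancel, Zp_zero, one_mul, one_mul, one_mul, ← sub_eq_neg_add]
    abel

theorem Zp_one_mul_X {i : ℕ} (hi : 1 ≤ i) : Zp P i 1 * Xg P i = Xgi P i * Zp P (i + 1) 1 := by
  rw [Zp_one, Zp_one, Yp_succ hi, Xi_mul_X_mul]

theorem pass_right_sub {i : ℕ} (hi : 1 ≤ i) (hn : i < P.n) {N : Submodule R (Alg P)}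
    (u : Alg P) (p : ℤ) : ∀ (v : Alg P),
    (∀ a, Bt p a → u * (Zp P i (p - a) * (Zp P (i + 1) a * v)) ∈ N) →
    (∀ a, Bt p a → u * (Zp P i (p - a) * (Eg P i * (Zp P (i + 1) a * v))) ∈ N) →
    u * (Zp P i p * (Xg P i * v)) - u * (Xg P i * (Zp P (i + 1) p * v)) ∈ N := by
  have key : ∀ (p : ℤ) (v : Alg P), Zp P i (p + 1) * (Xg P i * v)
      = Zp P i p * (Xg P i * (Zp P (i + 1) 1 * v))
      - P.delta • (Zp P i p * (Zp P (i + 1) 1 * v))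
      + P.delta • (Zp P i p * (Eg P i * (Zp P (i + 1) 1 * v))) := by
    intro p v
    rw [Zp_add, mul_assoc, mul_assoc_of_eq (Zp_one_mul_X hi), mul_assoc, Xi_eq hi hn]
    simp only [sub_mul, mul_sub, smul_mul_assoc, mul_smul_comm, one_mul, smul_sub]
    abel
  induction p using Int.induction_on with
  | zero => intro v _ _; simp
  | succ p ih =>
    intro v h1 h2
    have hp := ih (Zp P (i + 1) 1 * v)
      (fun a ha => by
        have := h1 (a + 1) (by unfold Bt at *; omega)
        rw [add_sub_add_right_eq_sub, Zp_add] at this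
        simpa only [mul_assoc] using this)
      (fun a ha => by
        have := h2 (a + 1) (by unfold Bt at *; omega)
        rw [add_sub_add_right_eq_sub, Zp_add] at this
        simpa only [mul_assoc] using this)
    have q1 := h1 1 (by unfold Bt; omega)
    have q2 := h2 1 (by unfold Bt; omega)
    rw [add_sub_cancel_right] at q1 q2
    have := N.add_mem (N.sub_mem hp (N.smul_mem P.delta q1)) (N.smul_mem P.delta q2)
    rw [key, Zp_add]
    convert this using 1
    simp only [mul_add, mul_sub, mul_smul_comm, mul_assoc]
    abel
  | pred p ih =>
    intro v h1 h2
    have hp := ih (Zp P (i + 1) (-1) * v)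
      (fun a ha => by
        have := h1 (a - 1) (by unfold Bt at *; omega)
        rw [sub_sub_sub_cancel_right, sub_eq_add_neg a 1, Zp_add] at this
        simpa only [mul_assoc] using this)
      (fun a ha => by
        have := h2 (a - 1) (by unfold Bt at *; omega)
        rw [sub_sub_sub_cancel_right, sub_eq_add_neg a 1, Zp_add] at this
        simpa only [mul_assoc] using this)
    have q1 := h1 0 (by unfold Bt; omega)
    have q2 := h2 0 (by unfold Bt; omega)
    rw [sub_zero, Zp_zero, one_mul] at q1 q2
    have := N.sub_mem (N.add_mem hp (N.smul_mem P.delta q1)) (N.smul_mem P.delta q2)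
    convert this using 1
    have hk := key (-(p : ℤ) - 1) (Zp P (i + 1) (-1) * v)
    rw [sub_add_cancel] at hk
    rw [hk]
    simp only [mul_add, mul_sub, mul_smul_comm, Zp_mul_Zp_mul]
    rw [add_neg_cancel, Zp_zero, one_mul, ← sub_eq_add_neg]
    abel

theorem pass_both_sub {i : ℕ} (hi : 1 ≤ i) (hn : i < P.n) {N : Submodule R (Alg P)}
    (u v : Alg P) (p : ℤ)
    (h1 : ∀ a, Bt (p - 1) a → u * (Zp P (i + 1) a * (Zp P i (p - a) * (Xg P i * v))) ∈ N)
    (h2 : ∀ a, Bt (p - 1) a →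
      u * (Zp P (i + 1) a * (Eg P i * (Zp P i (p - a) * (Xg P i * v)))) ∈ N) :
    u * (Xg P i * (Zp P i p * (Xg P i * v))) - u * (Zp P (i + 1) p * v) ∈ N := by
  have h := pass_left_sub hi hn (N := N) (Zp P i 1 * (Xg P i * v)) (p - 1) u
    (fun a ha => by
      have := h1 a ha
      rwa [Zp_mul_Zp_mul, show p - 1 - a + 1 = p - a by ring])
    (fun a ha => by
      have := h2 a ha
      rwa [Zp_mul_Zp_mul, show p - 1 - a + 1 = p - a by ring])
  rw [Zp_mul_Zp_mul, sub_add_cancel] at h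
  convert h using 3
  rw [← mul_assoc (Zp P i 1), Zp_one_mul_X hi, mul_assoc, X_mul_Xi_mul, Zp_mul_Zp_mul,
    sub_add_cancel]

/-! ### The cyclotomic relation -/

theorem Zp_one_cyclo : Zp P 1 P.k = ∑ i ∈ Finset.range P.k, P.qc i • Zp P 1 i := by
  have h : ∀ m : ℕ, Zp P 1 m = Yg P ^ m := fun m => by simp [Zp, Zu, Yp_one]
  have h0 := pr_eq (Rel.cyclo (P := P))
  simp only [h]
  simpa [Yg, map_sum] using h0

theorem Zp_one_eq_sum (p : ℤ) :
    Zp P 1 p = ∑ i ∈ Finset.range P.k, P.qc i • Zp P 1 (p - P.k + i) := by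
  have h := congrArg (fun x => Zp P 1 (p - P.k) * x) (Zp_one_cyclo (P := P))
  simpa only [Zp_mul_Zp, sub_add_cancel, Finset.mul_sum, mul_smul_comm] using h

theorem Zp_one_mem_of_lower (N : Submodule R (Alg P)) (u v : Alg P) (p : ℤ)
    (h : ∀ s : ℤ, 1 ≤ s → s ≤ P.k → u * (Zp P 1 (p - s) * v) ∈ N) : u * (Zp P 1 p * v) ∈ N := by
  rw [Zp_one_eq_sum, Finset.sum_mul, Finset.mul_sum]
  refine N.sum_mem fun i hi => ?_
  rw [Finset.mem_range] at hi
  rw [smul_mul_assoc, mul_smul_comm]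
  have := h (P.k - i) (by omega) (by omega)
  rw [show p - ((P.k : ℤ) - i) = p - P.k + i by ring] at this
  exact N.smul_mem _ this

theorem Zp_one_mem_of_upper (hk : 1 ≤ P.k) (hq0 : P.qc 0 = (P.q0 : R))
    (N : Submodule R (Alg P)) (u v : Alg P) (p : ℤ)
    (h : ∀ s : ℤ, 1 ≤ s → s ≤ P.k → u * (Zp P 1 (p + s) * v) ∈ N) : u * (Zp P 1 p * v) ∈ N := by
  obtain ⟨k, hk'⟩ := Nat.exists_eq_add_of_le' hk
  have h1 := Zp_one_eq_sum (P := P) (p + P.k)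
  rw [add_sub_cancel_right, hk', Finset.sum_range_succ', hq0, Nat.cast_zero, add_zero] at h1
  have h2 : P.q0 • (u * (Zp P 1 p * v)) ∈ N := by
    have h3 : (P.q0 : R) • Zp P 1 p = Zp P 1 (p + (k + 1 : ℕ))
        - ∑ i ∈ Finset.range k, P.qc (i + 1) • Zp P 1 (p + (i + 1 : ℕ)) := by
      rw [h1]; abel
    rw [Units.smul_def, ← mul_smul_comm, ← smul_mul_assoc, h3, sub_mul, mul_sub, Finset.sum_mul,
      Finset.mul_sum]
    refine N.sub_mem (h _ (by omega) (by omega)) (N.sum_mem fun i hi => ?_)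
    rw [Finset.mem_range] at hi
    rw [smul_mul_assoc, mul_smul_comm]
    exact N.smul_mem _ (h _ (by omega) (by omega))
  simpa using N.smul_mem ((P.q0⁻¹ : Rˣ) : R) h2

/-! ### The elements `eᵢ (Yᵢ')^p eᵢ` -/

/-- The submodule `{z eᵢ : z ∈ Low i}`. -/
def LowE (P : Params R) (i : ℕ) : Submodule R (Alg P) :=
  (Subalgebra.toSubmodule (Low P i)).map (LinearMap.mulRight R (Eg P i))

theorem mem_LowE {i : ℕ} {x : Alg P} : x ∈ LowE P i ↔ ∃ z ∈ Low P i, z * Eg P i = x := by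
  simp [LowE]

theorem mul_E_mem_LowE {i : ℕ} {z : Alg P} (hz : z ∈ Low P i) : z * Eg P i ∈ LowE P i :=
  mem_LowE.2 ⟨z, hz, rfl⟩

theorem E_mem_LowE (i : ℕ) : Eg P i ∈ LowE P i := mem_LowE.2 ⟨1, one_mem _, one_mul _⟩

theorem mul_mem_LowE {i : ℕ} {z x : Alg P} (hz : z ∈ Low P i) (hx : x ∈ LowE P i) :
    z * x ∈ LowE P i := by
  obtain ⟨y, hy, rfl⟩ := mem_LowE.1 hx
  exact mem_LowE.2 ⟨z * y, mul_mem hz hy, mul_assoc _ _ _⟩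

theorem E_mul_E {i : ℕ} : Eg P i * Eg P i = P.A 0 • Eg P i := by
  by_cases hi : i = 0 ∨ P.n - 1 < i
  · simp [E_of_invalid hi]
  simpa [Eg] using pr_eq (Rel.E_sq (P := P) (i := i) (by omega) (by omega))

theorem mem_of_sub_mem {N : Submodule R (Alg P)} {x y : Alg P} (h : x - y ∈ N) (hy : y ∈ N) :
    x ∈ N := by simpa using N.add_mem h hy

theorem mem_of_sub_mem' {N : Submodule R (Alg P)} {x y : Alg P} (h : x - y ∈ N) (hx : x ∈ N) :
    y ∈ N := by simpa using N.sub_mem hx h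

theorem E_Zp_E_one (hk : 1 ≤ P.k) (hq0 : P.qc 0 = (P.q0 : R)) (hn : 1 < P.n) (p : ℤ) :
    Eg P 1 * (Zp P 1 p * Eg P 1) ∈ LowE P 1 := by
  have hnat : ∀ p : ℕ, Eg P 1 * (Zp P 1 p * Eg P 1) ∈ LowE P 1 := by
    intro p
    induction p using Nat.strong_induction_on with
    | _ p ih =>
      by_cases hp : p < P.k
      · have h := pr_eq (Rel.EYE (P := P) (m := p) (by omega) (by omega))
        have h' : Eg P 1 * (Zp P 1 p * Eg P 1) = P.A p • Eg P 1 := by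
          have : Zp P 1 p = Yg P ^ p := by simp [Zp, Zu, Yp_one]
          rw [this, ← mul_assoc]
          simpa [Eg, Yg] using h
        rw [h']
        exact Submodule.smul_mem _ _ (E_mem_LowE 1)
      · refine Zp_one_mem_of_lower _ _ _ _ fun s h1 h2 => ?_
        have := ih (p - s.toNat) (by omega)
        rwa [show ((p - s.toNat : ℕ) : ℤ) = (p : ℤ) - s by omega] at this
  have hneg : ∀ p : ℕ, Eg P 1 * (Zp P 1 (-p) * Eg P 1) ∈ LowE P 1 := by
    intro p
    induction p using Nat.strong_induction_on with
    | _ p ih =>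
      refine Zp_one_mem_of_upper hk hq0 _ _ _ _ fun s h1 h2 => ?_
      rcases le_or_gt s p with h | h
      · have := ih (p - s.toNat) (by omega)
        rwa [show -((p - s.toNat : ℕ) : ℤ) = -(p : ℤ) + s by omega] at this
      · have := hnat (s - p).toNat
        rwa [show (((s - p).toNat : ℕ) : ℤ) = -(p : ℤ) + s by omega] at this
  rcases le_total 0 p with h | h
  · obtain ⟨m, rfl⟩ := Int.eq_ofNat_of_zero_le h
    exact hnat m
  · have := hneg (-p).toNat
    rwa [show -(((-p).toNat : ℕ) : ℤ) = p by omega] at this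

theorem Xi_mul_Xi {i : ℕ} (hi : 1 ≤ i) (hn : i < P.n) :
    Xgi P i * Xgi P i = 1 - P.delta • Xgi P i + (P.delta * P.laminv) • Eg P i := by
  calc Xgi P i * Xgi P i = (Xg P i - P.delta • (1 - Eg P i)) * Xgi P i := by rw [← Xi_eq hi hn]
    _ = _ := by
      simp only [sub_mul, smul_mul_assoc, X_mul_Xi, E_mul_Xi, one_mul, smul_sub, mul_smul]
      abel

theorem X_mul_X {i : ℕ} (hi : 1 ≤ i) (hn : i < P.n) :
    Xg P i * Xg P i = 1 + P.delta • Xg P i - (P.delta * (P.lam : R)) • Eg P i := by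
  have h : Xg P i = Xgi P i + P.delta • (1 - Eg P i) := by rw [Xi_eq hi hn]; abel
  calc Xg P i * Xg P i = (Xgi P i + P.delta • (1 - Eg P i)) * Xg P i := by rw [← h]
    _ = _ := by
      simp only [add_mul, sub_mul, smul_mul_assoc, Xi_mul_X, E_mul_X, one_mul, smul_sub, mul_smul]
      abel

theorem E_Zp_E_succ {i : ℕ} (hi : 1 ≤ i) (hn : i + 1 < P.n)
    (ih : ∀ p, Eg P i * (Zp P i p * Eg P i) ∈ LowE P i) (p : ℤ) :
    Eg P (i + 1) * (Zp P (i + 1) p * Eg P (i + 1)) ∈ LowE P (i + 1) := by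
  have hn' : i < P.n := by omega
  have hfW : ∀ s, Commute (Eg P (i + 1)) (Zp P i s) := E_commute_Zp_of_lt hi le_rfl
  have hViW : ∀ s, Commute (Zp P i s) (Xgi P (i + 1)) := fun s =>
    commute_Xi_right (X_commute_Zp_of_lt hi le_rfl s).symm
  have hWZ : ∀ a b, Commute (Zp P i a) (Zp P (i + 1) b) :=
    Zp_commute_Zp hi hn'.le (by omega) hn.le
  have hWL : ∀ s, Zp P i s ∈ Low P (i + 1) := Zp_mem_Low hi (by omega)
  have hZe : ∀ a (x : Alg P), Zp P (i + 1) a * (Eg P i * x) = Zp P i (-a) * (Eg P i * x) := by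
    intro a x
    rw [mul_assoc_of_eq (Zp_succ_mul_E hi hn' a), mul_assoc]
  have hfef : Eg P (i + 1) * (Eg P i * Eg P (i + 1)) = Eg P (i + 1) :=
    E_E_E (by omega) hn hi hn' (by omega)
  have hXf : Xg P i * Eg P (i + 1) = Xgi P (i + 1) * (Eg P i * Eg P (i + 1)) :=
    X_E_adj (by omega) hn hi hn' (by omega)
  have hfX : ∀ x, Eg P (i + 1) * (Xg P i * x) = Eg P (i + 1) * (Eg P i * (Xgi P (i + 1) * x)) := by
    intro x
    rw [mul_assoc_of_eq (E_X_adj hi hn' (by omega) hn (by omega))]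
    simp only [mul_assoc]
  have hfef' : ∀ x, Eg P (i + 1) * (Eg P i * (Eg P (i + 1) * x)) = Eg P (i + 1) * x := by
    intro x
    rw [← mul_assoc (Eg P i), mul_assoc_of_eq hfef]
  have hzf : ∀ p, ∃ z ∈ Low P i, Commute (Eg P (i + 1)) z ∧
      ∀ x, Eg P i * (Zp P i p * (Eg P i * x)) = z * (Eg P i * x) := by
    intro p
    obtain ⟨z, hz, h⟩ := mem_LowE.1 (ih p)
    refine ⟨z, hz, E_commute_Low hz (by omega), fun x => ?_⟩
    rw [← mul_assoc z, h]
    simp only [mul_assoc]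
  have ha : ∀ p, Eg P (i + 1) * (Xg P i * (Zp P i p * (Eg P i * Eg P (i + 1)))) ∈
      LowE P (i + 1) := by
    intro p
    refine mem_of_sub_mem (pass_left_sub hi hn' _ p _ (fun a _ => ?_) fun a _ => ?_) ?_
    · rw [(hWZ _ _).symm.left_comm, hZe, (hfW _).left_comm, (hfW _).left_comm, hfef,
        Zp_mul_Zp_mul]
      exact mul_E_mem_LowE (hWL _)
    · obtain ⟨z, hz, hc, h⟩ := hzf (p - a)
      rw [hZe, h, (hfW _).left_comm, hc.left_comm, hfef]
      exact mul_mem_LowE (hWL _) (mul_E_mem_LowE (Low_mono (by omega) hz))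
    · rw [← mul_assoc (Xg P i), X_mul_E, smul_mul_assoc, mul_smul_comm, mul_smul_comm, hZe,
        (hfW _).left_comm, hfef]
      exact Submodule.smul_mem _ _ (mul_E_mem_LowE (hWL _))
  have hb : ∀ p, Eg P (i + 1) * (Eg P i * (Zp P i p * (Xg P i * Eg P (i + 1)))) ∈
      LowE P (i + 1) := by
    intro p
    rw [hXf, (hViW p).left_comm, ← hfX]
    exact ha p
  have hc : ∀ p, Eg P (i + 1) * (Xg P i * (Zp P i p * (Xg P i * Eg P (i + 1)))) ∈
      LowE P (i + 1) := by
    intro p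
    rw [hfX, hXf, ← (hViW p).left_comm, ← mul_assoc (Xgi P (i + 1)), Xi_mul_Xi (by omega) hn]
    simp only [add_mul, sub_mul, mul_add, mul_sub, smul_mul_assoc, mul_smul_comm, one_mul]
    refine Submodule.add_mem _ (Submodule.sub_mem _ ?_ (Submodule.smul_mem _ _ ?_))
      (Submodule.smul_mem _ _ ?_)
    · obtain ⟨z, hz, hc, h⟩ := hzf p
      rw [h, hc.left_comm, hfef]
      exact mul_E_mem_LowE (Low_mono (by omega) hz)
    · rw [← hXf]
      exact hb p
    · rw [hfef, ← (hfW p).eq, hfef', (hfW p).eq]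
      exact mul_E_mem_LowE (hWL _)
  have hfXf : Eg P (i + 1) * (Xg P i * Eg P (i + 1)) = P.laminv • Eg P (i + 1) := by
    rw [hfX, Xi_mul_E, mul_smul_comm, mul_smul_comm, hfef]
  have hg : ∀ m : ℕ, Eg P (i + 1) * (Zp P (i + 1) m * Eg P (i + 1)) ∈ LowE P (i + 1) ∧
      Eg P (i + 1) * (Zp P (i + 1) (-m) * Eg P (i + 1)) ∈ LowE P (i + 1) := by
    intro m
    induction m using Nat.strong_induction_on with
    | _ m ihm =>
      have hlt : ∀ a : ℤ, -m < a → a < m →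
          Eg P (i + 1) * (Zp P (i + 1) a * Eg P (i + 1)) ∈ LowE P (i + 1) := by
        intro a h1 h2
        rcases le_total 0 a with h | h
        · have := (ihm a.toNat (by omega)).1
          rwa [show ((a.toNat : ℕ) : ℤ) = a by omega] at this
        · have := (ihm (-a).toNat (by omega)).2
          rwa [show -(((-a).toNat : ℕ) : ℤ) = a by omega] at this
      rcases Nat.eq_zero_or_pos m with rfl | hm
      · simpa [E_mul_E] using Submodule.smul_mem _ (P.A 0) (E_mem_LowE (P := P) (i + 1))
      have hh : ∀ a : ℤ, 1 ≤ a → a < m →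
          Eg P (i + 1) * (Zp P (i + 1) a * (Xg P i * Eg P (i + 1))) ∈ LowE P (i + 1) := by
        intro a h1 h2
        refine mem_of_sub_mem' (pass_left_sub hi hn' _ a _ (fun c hc => ?_) fun c hc => ?_) ?_
        · unfold Bt at hc
          rw [← (hWZ _ _).left_comm, (hfW _).left_comm]
          exact mul_mem_LowE (hWL _) (hlt c (by omega) (by omega))
        · rw [hZe, (hfW _).left_comm, ← (hfW _).eq, hfef', (hfW _).eq, Zp_mul_Zp_mul]
          exact mul_E_mem_LowE (hWL _)
        · rw [← (hfW _).eq, ← mul_assoc (Xg P i), mul_assoc_of_eq hfXf, smul_mul_assoc,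
            (hfW _).eq]
          exact Submodule.smul_mem _ _ (mul_E_mem_LowE (hWL _))
      have hpos : Eg P (i + 1) * (Zp P (i + 1) m * Eg P (i + 1)) ∈ LowE P (i + 1) := by
        refine mem_of_sub_mem' (pass_both_sub hi hn' _ _ _ (fun a ha' => ?_) fun a ha' => ?_)
          (hc m)
        · unfold Bt at ha'
          rw [← (hWZ _ _).left_comm, (hfW _).left_comm]
          exact mul_mem_LowE (hWL _) (hh a (by omega) (by omega))
        · rw [hZe, (hfW _).left_comm]
          exact mul_mem_LowE (hWL _) (hb _)
      refine ⟨hpos, ?_⟩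
      have hVf := X_mul_E (P := P) (i + 1)
      have hcomm := Zp_commute_Zp (P := P) (i := i + 1) (j := i + 2) (by omega) hn.le (by omega) hn
      rw [← Zp_succ_mul_E (by omega) hn]
      refine mem_of_sub_mem' (pass_both_sub (by omega) hn _ _ _ (fun a ha' => ?_) fun a ha' => ?_)
        ?_
      · unfold Bt at ha'
        rw [hVf, mul_smul_comm, mul_smul_comm, mul_smul_comm, ← (hcomm _ _).left_comm,
          Zp_succ_mul_E (by omega) hn, Zp_mul_Zp_mul]
        exact Submodule.smul_mem _ _ (hlt _ (by omega) (by omega))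
      · unfold Bt at ha'
        rw [hVf, mul_smul_comm, mul_smul_comm, mul_smul_comm, mul_smul_comm,
          mul_assoc_of_eq (Zp_succ_mul_E (by omega) hn _), mul_assoc]
        obtain ⟨z, hz, h⟩ := mem_LowE.1 (hlt (-a) (by omega) (by omega))
        have h' : ∀ x, Eg P (i + 1) * (Zp P (i + 1) (-a) * (Eg P (i + 1) * x))
            = z * (Eg P (i + 1) * x) := by
          intro x
          rw [← mul_assoc z, h]
          simp only [mul_assoc]
        rw [h']
        exact Submodule.smul_mem _ _ (mul_mem_LowE hz (hlt _ (by omega) (by omega)))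
      · rw [mul_assoc_of_eq (E_mul_X (P := P) (i + 1)), hVf, smul_mul_assoc, mul_smul_comm,
          mul_smul_comm]
        exact Submodule.smul_mem _ _ (Submodule.smul_mem _ _ hpos)
  rcases le_total 0 p with h | h
  · have := (hg p.toNat).1
    rwa [show ((p.toNat : ℕ) : ℤ) = p by omega] at this
  · have := (hg (-p).toNat).2
    rwa [show -(((-p).toNat : ℕ) : ℤ) = p by omega] at this

theorem E_Zp_E (hk : 1 ≤ P.k) (hq0 : P.qc 0 = (P.q0 : R)) {i : ℕ} (hi : 1 ≤ i) (hn : i < P.n)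
    (p : ℤ) : ∃ z ∈ Low P i, ∀ x, Eg P i * (Zp P i p * (Eg P i * x)) = z * (Eg P i * x) := by
  have h : ∀ p, Eg P i * (Zp P i p * Eg P i) ∈ LowE P i := by
    induction i, hi using Nat.le_induction with
    | base => exact E_Zp_E_one hk hq0 hn
    | succ i hi ih => exact E_Zp_E_succ hi hn (ih (by omega))
  obtain ⟨z, hz, h⟩ := mem_LowE.1 (h p)
  refine ⟨z, hz, fun x => ?_⟩
  rw [← mul_assoc z, h]
  simp only [mul_assoc]

/-! ### The products `Xᵢ ⋯ X_{j-1} e_j ⋯ e_r` -/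

/-- `Xᵢ Xᵢ₊₁ ⋯ X_{j-1}`. -/
def Xs (P : Params R) (i j : ℕ) : Alg P := ((List.range' i (j - i)).map fun t => Xg P t).prod

/-- `e_j e_{j+1} ⋯ e_r`. -/
def Es (P : Params R) (j r : ℕ) : Alg P := ((List.range' j (r + 1 - j)).map fun t => Eg P t).prod

/-- `Xᵢ ⋯ X_{j-1} e_j ⋯ e_r`. -/
def xi (P : Params R) (i j r : ℕ) : Alg P := Xs P i j * Es P j r

theorem alpha_eq (i j r : ℕ) (s : ℤ) : alpha P i j r s = Zp P i s * xi P i j r := by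
  rw [alpha, Ypow_eq, xi, mul_assoc]; rfl

@[simp] theorem Xs_self (i : ℕ) : Xs P i i = 1 := by simp [Xs]

theorem Xs_left {i j : ℕ} (h : i < j) : Xs P i j = Xg P i * Xs P (i + 1) j := by
  obtain ⟨m, rfl⟩ := Nat.exists_eq_add_of_lt h
  simp [Xs, show i + m + 1 - i = m + 1 by omega, show i + m + 1 - (i + 1) = m by omega,
    List.range'_succ]

theorem Xs_right {i j : ℕ} (h : i ≤ j) : Xs P i (j + 1) = Xs P i j * Xg P j := by
  obtain ⟨m, rfl⟩ := Nat.exists_eq_add_of_le h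
  simp [Xs, show i + m + 1 - i = m + 1 by omega, List.range'_concat]

theorem Xs_mul_Xs {i t j : ℕ} (h : i ≤ t) (h' : t ≤ j) : Xs P i t * Xs P t j = Xs P i j := by
  induction j, h' using Nat.le_induction with
  | base => simp
  | succ j hj ih => rw [Xs_right hj, Xs_right (h.trans hj), ← mul_assoc, ih]

theorem Es_of_lt {j r : ℕ} (h : r < j) : Es P j r = 1 := by
  simp [Es, show r + 1 - j = 0 by omega]

theorem Es_left {j r : ℕ} (h : j ≤ r) : Es P j r = Eg P j * Es P (j + 1) r := by
  obtain ⟨m, rfl⟩ := Nat.exists_eq_add_of_le h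
  simp [Es, show j + m + 1 - j = m + 1 by omega, show j + m - j = m by omega, List.range'_succ]

theorem Es_right {j r : ℕ} (h : j ≤ r + 1) : Es P j (r + 1) = Es P j r * Eg P (r + 1) := by
  obtain ⟨m, hm⟩ := Nat.exists_eq_add_of_le h
  rw [Es, Es, show r + 1 + 1 - j = m + 1 by omega, show r + 1 - j = m by omega,
    List.range'_concat]
  simp [hm]

theorem Es_mul_Es {j t r : ℕ} (h : j ≤ t + 1) (h' : t ≤ r) :
    Es P j t * Es P (t + 1) r = Es P j r := by
  induction r, h' using Nat.le_induction with
  | base => rw [Es_of_lt (Nat.lt_succ_self t), mul_one]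
  | succ r hr ih => rw [Es_right (by omega), Es_right (by omega), ← mul_assoc, ih]

theorem commute_Xs {x : Alg P} {i j : ℕ} (h : ∀ t, i ≤ t → t < j → Commute x (Xg P t)) :
    Commute x (Xs P i j) := by
  refine Commute.list_prod_right _ _ fun y hy => ?_
  obtain ⟨t, ht, rfl⟩ := List.mem_map.1 hy
  rw [List.mem_range'_1] at ht
  exact h t ht.1 (by omega)

theorem commute_Es {x : Alg P} {j r : ℕ} (h : ∀ t, j ≤ t → t ≤ r → Commute x (Eg P t)) :
    Commute x (Es P j r) := by
  refine Commute.list_prod_right _ _ fun y hy => ?_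
  obtain ⟨t, ht, rfl⟩ := List.mem_map.1 hy
  rw [List.mem_range'_1] at ht
  exact h t ht.1 (by omega)

theorem commute_xi {x : Alg P} {i j r : ℕ} (h : ∀ t, i ≤ t → t < j → Commute x (Xg P t))
    (h' : ∀ t, j ≤ t → t ≤ r → Commute x (Eg P t)) : Commute x (xi P i j r) :=
  (commute_Xs h).mul_right (commute_Es h')

theorem Xs_mem_Bsub {i j l : ℕ} (hi : 1 ≤ i) (h : j ≤ l) : Xs P i j ∈ Bsub P l := by
  refine Subalgebra.list_prod_mem _ fun y hy => ?_
  obtain ⟨t, ht, rfl⟩ := List.mem_map.1 hy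
  rw [List.mem_range'_1] at ht
  exact X_mem_Bsub (by omega) (by omega)

theorem Es_mem_Bsub {j r l : ℕ} (hj : 1 ≤ j) (h : r + 1 ≤ l) : Es P j r ∈ Bsub P l := by
  refine Subalgebra.list_prod_mem _ fun y hy => ?_
  obtain ⟨t, ht, rfl⟩ := List.mem_map.1 hy
  rw [List.mem_range'_1] at ht
  exact E_mem_Bsub (by omega) (by omega)

theorem Low_commute_xi {i j r : ℕ} (hij : i ≤ j) {z : Alg P} (hz : z ∈ Low P i) :
    Commute z (xi P i j r) :=
  commute_xi (fun _ h _ => (X_commute_Low hz h).symm)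
    (fun _ h _ => (E_commute_Low hz (hij.trans h)).symm)

theorem E_X_X_eq {t : ℕ} (ht : 1 ≤ t) (hn : t + 1 < P.n) :
    Eg P (t + 1) * (Xg P t * Xg P (t + 1)) = Xg P t * (Xg P (t + 1) * Eg P t) := by
  rw [E_X_X ht (by omega) (by omega) hn (by omega), X_X_E ht (by omega) (by omega) hn (by omega)]

theorem xi_left {i j r : ℕ} (h : i < j) : xi P i j r = Xg P i * xi P (i + 1) j r := by
  rw [xi, Xs_left h, mul_assoc, ← xi]

theorem Xs_mul_xi {i t j r : ℕ} (h : i ≤ t) (h' : t ≤ j) :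
    Xs P i t * xi P t j r = xi P i j r := by
  rw [xi, ← mul_assoc, Xs_mul_Xs h h', ← xi]

theorem xi_self (j r : ℕ) : xi P j j r = Es P j r := by rw [xi, Xs_self, one_mul]

section

variable {i j r : ℕ}

theorem Xs_mul_eq_of_shift {t : ℕ} {x y : Alg P} (hit : i < t) (htj : t < j)
    (h : x * (Xg P (t - 1) * Xg P t) = Xg P (t - 1) * (Xg P t * y))
    (hx : ∀ a, a + 2 ≤ t → Commute x (Xg P a))
    (hy : ∀ a, t + 1 ≤ a → Commute y (Xg P a)) : x * Xs P i j = Xs P i j * y := by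
  obtain ⟨m, rfl⟩ := Nat.exists_eq_add_of_lt hit
  have h1 : Xs P i j
      = Xs P i (i + m) * (Xg P (i + m) * (Xg P (i + m + 1) * Xs P (i + m + 1 + 1) j)) := by
    rw [← Xs_left htj, ← Xs_left (by omega), Xs_mul_Xs (by omega) (by omega)]
  rw [Nat.add_sub_cancel] at h
  rw [h1, (commute_Xs fun a _ _ => hx a (by omega)).left_comm,
    ← mul_assoc (Xg P (i + m)), mul_assoc_of_eq h]
  simp only [mul_assoc]
  rw [(commute_Xs fun a _ _ => hy a (by omega)).eq]

theorem X_mul_xi_of_lt_of_lt (hi : 1 ≤ i) (hjr : j ≤ r) (hr : r < P.n) {t : ℕ} (hit : i < t)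
    (htj : t < j) : Xg P t * xi P i j r = xi P i j r * Xg P (t - 1) := by
  obtain ⟨m, rfl⟩ := Nat.exists_eq_add_of_lt hit
  have h := Xs_mul_eq_of_shift (P := P) (x := Xg P (i + m + 1)) (y := Xg P (i + m)) hit htj
    (by rw [Nat.add_sub_cancel]; exact (braid (by omega) (by omega)).symm)
    (fun a ha => XX_far (by omega)) (fun a ha => XX_far (by omega))
  rw [xi, ← mul_assoc, h, mul_assoc, (commute_Es fun a _ _ => XE_far (by omega)).eq, ← mul_assoc,
    Nat.add_sub_cancel]

theorem E_mul_xi_of_lt_of_lt (hi : 1 ≤ i) (hjr : j ≤ r) (hr : r < P.n) {t : ℕ} (hit : i < t)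
    (htj : t < j) : Eg P t * xi P i j r = xi P i j r * Eg P (t - 1) := by
  obtain ⟨m, rfl⟩ := Nat.exists_eq_add_of_lt hit
  have h := Xs_mul_eq_of_shift (P := P) (x := Eg P (i + m + 1)) (y := Eg P (i + m)) hit htj
    (by rw [Nat.add_sub_cancel]; exact E_X_X_eq (by omega) (by omega))
    (fun a ha => (XE_far (by omega)).symm) (fun a ha => (XE_far (by omega)).symm)
  rw [xi, ← mul_assoc, h, mul_assoc, (commute_Es fun a _ _ => EE_far (by omega)).eq, ← mul_assoc,
    Nat.add_sub_cancel]

theorem X_mul_xi_succ (hi : 1 ≤ i) (hij : i ≤ j) (hjr : j + 1 ≤ r) (hr : r < P.n) :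
    Xg P (j + 1) * xi P i (j + 1) r = xi P i j r := by
  have h : Commute (Xg P (j + 1)) (Xs P i j) := commute_Xs fun a _ _ => XX_far (by omega)
  have h2 : Xg P (j + 1) * (Xg P j * Eg P (j + 1)) = Eg P j * Eg P (j + 1) :=
    X_X_E (by omega) (by omega) (by omega) (by omega) (by omega)
  rw [xi, Xs_right hij, mul_assoc, h.left_comm, Es_left hjr, ← mul_assoc (Xg P j),
    mul_assoc_of_eq h2, mul_assoc, ← Es_left hjr, ← Es_left (by omega), ← xi]

theorem E_mul_xi_succ (hi : 1 ≤ i) (hij : i ≤ j) (hjr : j + 1 ≤ r) (hr : r < P.n) :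
    Eg P (j + 1) * xi P i (j + 1) r = P.laminv • (xi P (j + 1) (j + 1) r * Xs P i j) := by
  have h : Commute (Eg P (j + 1)) (Xs P i j) :=
    commute_Xs fun a _ _ => (XE_far (by omega)).symm
  have h2 : Eg P (j + 1) * (Xg P j * Eg P (j + 1)) = P.laminv • Eg P (j + 1) := by
    rw [mul_assoc_of_eq (E_X_adj (i := j) (j := j + 1) (by omega) (by omega) (by omega)
      (by omega) (by omega))]
    simp only [mul_assoc, Xi_mul_E, mul_smul_comm]
    rw [E_E_E (by omega) (by omega) (by omega) (by omega) (by omega)]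
  have h3 : Commute (Xs P i j) (Es P (j + 1) r) :=
    (commute_Xs fun a _ _ => (commute_Es fun b _ _ => XE_far (by omega)).symm).symm
  rw [xi, Xs_right hij, mul_assoc, h.left_comm, Es_left hjr, ← mul_assoc (Xg P j),
    mul_assoc_of_eq h2, smul_mul_assoc, ← Es_left hjr, mul_smul_comm, h3.eq, xi_self]

theorem Xi_mul_xi_eq_succ (hi : 1 ≤ i) (hij : i ≤ j) (hjr : j + 1 ≤ r) (hr : r < P.n) :
    Xgi P (j + 1) * xi P i j r = xi P i (j + 1) r := by
  rw [← X_mul_xi_succ hi hij hjr hr, Xi_mul_X_mul]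

theorem E_succ_mul_xi (hi : 1 ≤ i) (hij : i ≤ j) (hjr : j + 1 ≤ r) (hr : r < P.n) :
    Eg P (j + 1) * xi P i j r = xi P (j + 1) (j + 1) r * Xs P i j := by
  rw [← X_mul_xi_succ hi hij hjr hr, mul_assoc_of_eq (E_mul_X (P := P) (j + 1)), smul_mul_assoc,
    E_mul_xi_succ hi hij hjr hr, lam_smul_laminv_smul]

theorem xi_mul_eq_of_shift {t : ℕ} {x y : Alg P} (hij : i ≤ j) (hjt : j ≤ t) (htr : t + 2 ≤ r)
    (h : x * (Eg P t * (Eg P (t + 1) * Eg P (t + 2)))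
      = Eg P t * (Eg P (t + 1) * (Eg P (t + 2) * y)))
    (hx : ∀ a, a < t → Commute x (Xg P a) ∧ Commute x (Eg P a))
    (hy : ∀ a, t + 3 ≤ a → Commute y (Eg P a)) : x * xi P i j r = xi P i j r * y := by
  have h1 : ∃ w, Commute x w ∧
      xi P i j r = w * (Eg P t * (Eg P (t + 1) * (Eg P (t + 2) * Es P (t + 3) r))) := by
    rw [← Es_left htr, ← Es_left (by omega), ← Es_left (by omega), xi]
    rcases Nat.eq_zero_or_pos t with rfl | ht
    · obtain rfl : j = 0 := by omega
      exact ⟨Xs P i 0, commute_Xs fun a _ ha => by omega, rfl⟩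
    · obtain ⟨m, rfl⟩ := Nat.exists_eq_add_of_le' ht
      refine ⟨Xs P i j * Es P j m, (commute_Xs fun a _ _ => (hx a (by omega)).1).mul_right
        (commute_Es fun a _ _ => (hx a (by omega)).2), ?_⟩
      rw [mul_assoc, Es_mul_Es hjt (by omega)]
  obtain ⟨w, hw, h1⟩ := h1
  have h2 : x * (Eg P t * (Eg P (t + 1) * (Eg P (t + 2) * Es P (t + 3) r)))
      = Eg P t * (Eg P (t + 1) * (Eg P (t + 2) * (y * Es P (t + 3) r))) := by
    have := congrArg (· * Es P (t + 3) r) h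
    simpa only [mul_assoc] using this
  rw [h1, hw.left_comm, h2, (commute_Es fun a _ _ => hy a (by omega)).eq]
  simp only [mul_assoc]

theorem X_mul_xi_of_gt (hi : 1 ≤ i) (hij : i ≤ j) (hr : r < P.n) {t : ℕ} (hjt : j ≤ t)
    (htr : t + 2 ≤ r) : Xg P (t + 2) * xi P i j r = xi P i j r * Xg P t := by
  refine xi_mul_eq_of_shift hij hjt htr ?_
    (fun a _ => ⟨XX_far (by omega), XE_far (by omega)⟩) (fun a _ => XE_far (by omega))
  have h1 : Xg P (t + 2) * (Eg P (t + 1) * Eg P (t + 2)) = Xgi P (t + 1) * Eg P (t + 2) := by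
    rw [mul_assoc_of_eq (X_E_adj (i := t + 1) (j := t + 2) (by omega) (by omega) (by omega)
      (by omega) (by omega)), mul_assoc, mul_assoc,
      E_E_E (by omega) (by omega) (by omega) (by omega) (by omega)]
  have h2 : Eg P t * Xgi P (t + 1) = Eg P t * (Eg P (t + 1) * Xg P t) := by
    have h3 : Eg P (t + 1) * (Xg P t * Xg P (t + 1)) = Eg P (t + 1) * Eg P t :=
      E_X_X (by omega) (by omega) (by omega) (by omega) (by omega)
    have h4 : Eg P t * (Eg P (t + 1) * Eg P t) = Eg P t :=
      E_E_E (by omega) (by omega) (by omega) (by omega) (by omega)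
    rw [← h3] at h4
    conv_lhs => rw [← h4]
    simp only [mul_assoc, X_mul_Xi, mul_one]
  rw [(XE_far (P := P) (i := t + 2) (j := t) (by omega)).left_comm, h1, mul_assoc_of_eq h2,
    (XE_far (P := P) (i := t) (j := t + 2) (by omega)).symm.eq]
  simp only [mul_assoc]

theorem E_mul_xi_of_gt (hi : 1 ≤ i) (hij : i ≤ j) (hr : r < P.n) {t : ℕ} (hjt : j ≤ t)
    (htr : t + 2 ≤ r) : Eg P (t + 2) * xi P i j r = xi P i j r * Eg P t := by
  refine xi_mul_eq_of_shift hij hjt htr ?_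
    (fun a _ => ⟨(XE_far (by omega)).symm, EE_far (by omega)⟩) (fun a _ => EE_far (by omega))
  have hc := EE_far (P := P) (i := t + 2) (j := t) (by omega)
  have h1 : Eg P (t + 2) * (Eg P (t + 1) * Eg P (t + 2)) = Eg P (t + 2) :=
    E_E_E (by omega) (by omega) (by omega) (by omega) (by omega)
  have h2 : Eg P t * (Eg P (t + 1) * Eg P t) = Eg P t :=
    E_E_E (by omega) (by omega) (by omega) (by omega) (by omega)
  rw [hc.left_comm, h1, hc.eq, ← mul_assoc (Eg P (t + 1)), mul_assoc_of_eq h2]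

theorem xi_mul_Zp (hi : 1 ≤ i) (hij : i ≤ j) (hr : r < P.n) {t : ℕ} (hjt : j ≤ t)
    (htr : t + 1 ≤ r) (s : ℤ) : xi P i j r * Zp P t s = Zp P (t + 2) s * xi P i j r := by
  have hE : ∃ w, Commute (Zp P (t + 2) s) w ∧
      xi P i j r = w * (Eg P t * (Eg P (t + 1) * Es P (t + 2) r)) := by
    obtain ⟨m, rfl⟩ := Nat.exists_eq_add_of_le' (show 1 ≤ t by omega)
    refine ⟨Xs P i j * Es P j m, Zp_commute_Bsub (l := m + 1) (mul_mem (Xs_mem_Bsub hi hjt)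
      (Es_mem_Bsub (by omega) le_rfl)) (by omega) (by omega) s, ?_⟩
    rw [← Es_left htr, ← Es_left (by omega), mul_assoc, Es_mul_Es hjt (by omega), xi]
  obtain ⟨w, hw, h⟩ := hE
  have h1 : Commute (Es P (t + 2) r) (Zp P t s) :=
    (commute_Es fun a _ _ => (E_commute_Zp_of_lt (by omega) (by omega) s).symm).symm
  have h2 : Commute (Eg P (t + 1)) (Zp P t s) := E_commute_Zp_of_lt (by omega) le_rfl s
  have h3 : Eg P t * Zp P t s = Eg P t * Zp P (t + 1) (-s) := by
    rw [E_mul_Zp_succ (by omega) (by omega), neg_neg]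
  have h4 : Zp P (t + 1) (-s) * Eg P (t + 1) = Zp P (t + 2) s * Eg P (t + 1) :=
    (Zp_succ_mul_E (by omega) (by omega) s).symm
  have h5 : Commute (Eg P t) (Zp P (t + 2) s) := E_commute_Zp_of_gt (by omega) le_rfl (by omega) s
  rw [h]
  simp only [mul_assoc]
  rw [h1.eq, h2.left_comm, mul_assoc_of_eq h3, mul_assoc, mul_assoc_of_eq h4, mul_assoc,
    h5.left_comm, hw.left_comm]

end

/-! ### Elements supported on a range of strands -/

/-- The subalgebra generated by `X_t, e_t` for `a ≤ t ≤ b`. -/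
def Gen (P : Params R) (a b : ℕ) : Subalgebra R (Alg P) :=
  Algebra.adjoin R {x | ∃ t, a ≤ t ∧ t ≤ b ∧ (x = Xg P t ∨ x = Eg P t)}

theorem X_mem_Gen {a b t : ℕ} (h : a ≤ t) (h' : t ≤ b) : Xg P t ∈ Gen P a b :=
  Algebra.subset_adjoin ⟨t, h, h', Or.inl rfl⟩

theorem E_mem_Gen {a b t : ℕ} (h : a ≤ t) (h' : t ≤ b) : Eg P t ∈ Gen P a b :=
  Algebra.subset_adjoin ⟨t, h, h', Or.inr rfl⟩

theorem Xi_mem_of_mem {S : Subalgebra R (Alg P)} {t : ℕ} (h1 : 1 ≤ t) (hn : t < P.n)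
    (hX : Xg P t ∈ S) (hE : Eg P t ∈ S) : Xgi P t ∈ S := by
  rw [Xi_eq h1 hn]
  exact S.sub_mem hX (S.smul_mem (S.sub_mem S.one_mem hE) _)

theorem Xi_mem_Gen {a b t : ℕ} (h1 : 1 ≤ t) (hn : t < P.n) (h : a ≤ t) (h' : t ≤ b) :
    Xgi P t ∈ Gen P a b := Xi_mem_of_mem h1 hn (X_mem_Gen h h') (E_mem_Gen h h')

theorem mul_mem_of_mem_adjoin {s : Set (Alg P)} {N : Submodule R (Alg P)}
    (h : ∀ g ∈ s, ∀ x ∈ N, g * x ∈ N) {y : Alg P} (hy : y ∈ Algebra.adjoin R s) :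
    ∀ x ∈ N, y * x ∈ N := by
  induction hy using Algebra.adjoin_induction with
  | mem g hg => exact h g hg
  | algebraMap c => intro x hx; rw [← Algebra.smul_def]; exact N.smul_mem c hx
  | add a b _ _ iha ihb => intro x hx; rw [add_mul]; exact N.add_mem (iha x hx) (ihb x hx)
  | mul a b _ _ iha ihb => intro x hx; rw [mul_assoc]; exact iha _ (ihb x hx)

/-- If generators can be moved from the right of `x` to the left (or conversely), so can all
elements of the generated subalgebra. -/
theorem exists_mul_eq_mul_of_adjoin {s : Set (Alg P)} {S : Subalgebra R (Alg P)} {x : Alg P}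
    (h : ∀ g ∈ s, ∃ c ∈ S, g * x = x * c) {y : Alg P} (hy : y ∈ Algebra.adjoin R s) :
    ∃ c ∈ S, y * x = x * c := by
  induction hy using Algebra.adjoin_induction with
  | mem g hg => exact h g hg
  | algebraMap c => exact ⟨algebraMap R _ c, S.algebraMap_mem c, Algebra.commutes c x⟩
  | add a b _ _ iha ihb =>
    obtain ⟨c, hc, ec⟩ := iha
    obtain ⟨d, hd, ed⟩ := ihb
    exact ⟨c + d, S.add_mem hc hd, by rw [add_mul, mul_add, ec, ed]⟩
  | mul a b _ _ iha ihb =>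
    obtain ⟨c, hc, ec⟩ := iha
    obtain ⟨d, hd, ed⟩ := ihb
    exact ⟨c * d, S.mul_mem hc hd, by rw [mul_assoc, ed, ← mul_assoc, ec, mul_assoc]⟩

theorem Gen_mul_xi_self {i r : ℕ} (hi : 1 ≤ i) (hr : r < P.n) {d : Alg P}
    (hd : d ∈ Gen P (i + 2) r) : ∃ c ∈ Bsub P (r - 1), d * xi P i i r = xi P i i r * c := by
  refine exists_mul_eq_mul_of_adjoin ?_ hd
  rintro g ⟨t, h1, h2, rfl | rfl⟩
  · obtain ⟨m, rfl⟩ := Nat.exists_eq_add_of_le' (show 2 ≤ t by omega)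
    exact ⟨_, X_mem_Bsub (t := m) (by omega) (by omega),
      X_mul_xi_of_gt hi le_rfl hr (by omega) h2⟩
  · obtain ⟨m, rfl⟩ := Nat.exists_eq_add_of_le' (show 2 ≤ t by omega)
    exact ⟨_, E_mem_Bsub (t := m) (by omega) (by omega),
      E_mul_xi_of_gt hi le_rfl hr (by omega) h2⟩

theorem E_mul_xi_of_lt {i j r : ℕ} (hi : 1 ≤ i) (hij : i < j) (hjr : j ≤ r) (hr : r < P.n) :
    ∃ d ∈ Gen P (i + 2) r, Eg P i * xi P (i + 1) j r = d * xi P i i r := by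
  induction j, hij using Nat.le_induction with
  | base => exact ⟨1, one_mem _, by rw [xi_self, xi_self, one_mul, ← Es_left (by omega)]⟩
  | succ j hj ih =>
    obtain ⟨d, hd, h⟩ := ih (by omega)
    refine ⟨Xgi P (j + 1) * d, mul_mem (Xi_mem_Gen (by omega) (by omega) (by omega) hjr) hd, ?_⟩
    rw [← Xi_mul_xi_eq_succ (by omega) hj hjr hr,
      (commute_Xi_right (XE_far (P := P) (i := j + 1) (j := i) (by omega)).symm).left_comm, h,
      mul_assoc]

/-! ### Spans of the elements `α_{ijr}^s` over `B_{r-1}` -/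

/-- The right `B_{r-1}`-submodule spanned by the `α_{ijr}^s` for which `S i s` holds. -/
def NN (P : Params R) (r : ℕ) (S : ℕ → ℤ → Prop) : Submodule R (Alg P) :=
  Submodule.span R {x | ∃ i j s c, 1 ≤ i ∧ i ≤ j ∧ j ≤ r ∧ S i s ∧ c ∈ Bsub P (r - 1) ∧
    x = Zp P i s * (xi P i j r * c)}

theorem NN_le {r : ℕ} {S : ℕ → ℤ → Prop} {N : Submodule R (Alg P)}
    (h : ∀ i j s c, 1 ≤ i → i ≤ j → j ≤ r → S i s → c ∈ Bsub P (r - 1) →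
      Zp P i s * (xi P i j r * c) ∈ N) : NN P r S ≤ N := by
  refine Submodule.span_le.2 ?_
  rintro _ ⟨i, j, s, c, h1, h2, h3, h4, h5, rfl⟩
  exact h i j s c h1 h2 h3 h4 h5

theorem mul_mem_NN_right {r : ℕ} {S : ℕ → ℤ → Prop} {x c : Alg P} (hx : x ∈ NN P r S)
    (hc : c ∈ Bsub P (r - 1)) : x * c ∈ NN P r S := by
  have : NN P r S ≤ (NN P r S).comap (LinearMap.mulRight R c) :=
    NN_le fun i j s d h1 h2 h3 h4 h5 => Submodule.subset_span
      ⟨i, j, s, d * c, h1, h2, h3, h4, mul_mem h5 hc, by simp [mul_assoc]⟩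
  exact this hx

theorem mul_mem_NN_left {r : ℕ} {S S' : ℕ → ℤ → Prop} {g : Alg P}
    (h : ∀ i j s, 1 ≤ i → i ≤ j → j ≤ r → S i s → g * (Zp P i s * xi P i j r) ∈ NN P r S')
    {x : Alg P} (hx : x ∈ NN P r S) : g * x ∈ NN P r S' := by
  have : NN P r S ≤ (NN P r S').comap (LinearMap.mulLeft R g) :=
    NN_le fun i j s d h1 h2 h3 h4 h5 => by
      have := mul_mem_NN_right (h i j s h1 h2 h3 h4) h5
      simpa only [Submodule.mem_comap, LinearMap.mulLeft_apply, mul_assoc] using this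
  exact this hx

theorem mul_gen_mem_NN {i j r : ℕ} {s : ℤ} {S : ℕ → ℤ → Prop} {z c : Alg P} (hi : 1 ≤ i)
    (hij : i ≤ j) (hjr : j ≤ r) (hr : r < P.n) (hS : S i s) (hz : z ∈ Low P i)
    (hc : c ∈ Bsub P (r - 1)) : z * (Zp P i s * (xi P i j r * c)) ∈ NN P r S := by
  rw [(Zp_commute_Low hz hi le_rfl (by omega) s).symm.left_comm, (Low_commute_xi hij hz).left_comm]
  exact Submodule.subset_span
    ⟨i, j, s, z * c, hi, hij, hjr, hS, mul_mem (Low_le_Bsub (by omega) hz) hc, rfl⟩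

theorem gen_mul_mem_NN {i j r : ℕ} {s : ℤ} {S : ℕ → ℤ → Prop} {c : Alg P} (hi : 1 ≤ i)
    (hij : i ≤ j) (hjr : j ≤ r) (hS : S i s) (hc : c ∈ Bsub P (r - 1)) :
    Zp P i s * (xi P i j r * c) ∈ NN P r S :=
  Submodule.subset_span ⟨i, j, s, c, hi, hij, hjr, hS, hc, rfl⟩

theorem gen_mem_NN {i j r : ℕ} {s : ℤ} {S : ℕ → ℤ → Prop} (hi : 1 ≤ i)
    (hij : i ≤ j) (hjr : j ≤ r) (hS : S i s) : Zp P i s * xi P i j r ∈ NN P r S := by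
  simpa using gen_mul_mem_NN (P := P) hi hij hjr hS (one_mem _)

theorem NN_mono {r : ℕ} {S S' : ℕ → ℤ → Prop} (h : ∀ i s, 1 ≤ i → i ≤ r → S i s → S' i s) :
    NN P r S ≤ NN P r S' :=
  NN_le fun i _ s _ h1 h2 h3 h4 h5 => gen_mul_mem_NN h1 h2 h3 (h i s h1 (h2.trans h3) h4) h5

theorem X_eq {t : ℕ} (h1 : 1 ≤ t) (hn : t < P.n) :
    Xg P t = Xgi P t + P.delta • (1 - Eg P t) := by
  rw [Xi_eq h1 hn]; abel

theorem X_mul_mem_of {N : Submodule R (Alg P)} {t : ℕ} {x : Alg P} (h1 : 1 ≤ t) (hn : t < P.n)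
    (h : Xgi P t * x ∈ N) (hx : x ∈ N) (he : Eg P t * x ∈ N) : Xg P t * x ∈ N := by
  rw [X_eq h1 hn, add_mul, smul_mul_assoc, sub_mul, one_mul]
  exact N.add_mem h (N.smul_mem _ (N.sub_mem hx he))

theorem Xi_mul_mem_of {N : Submodule R (Alg P)} {t : ℕ} {x : Alg P} (h1 : 1 ≤ t) (hn : t < P.n)
    (h : Xg P t * x ∈ N) (hx : x ∈ N) (he : Eg P t * x ∈ N) : Xgi P t * x ∈ N := by
  rw [Xi_eq h1 hn, sub_mul, smul_mul_assoc, sub_mul, one_mul]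
  exact N.sub_mem h (N.smul_mem _ (N.sub_mem hx he))

theorem XE_mul_mem_NN_of_lt {i j r t : ℕ} {s : ℤ} {S : ℕ → ℤ → Prop} (hi : 1 ≤ i) (hij : i ≤ j)
    (hjr : j ≤ r) (hr : r < P.n) (hit : i < t) (htr : t ≤ r) (h1 : S i s)
    (h2 : ∀ i', i < i' → i' ≤ r → S i' 0) :
    Xg P t * (Zp P i s * xi P i j r) ∈ NN P r S ∧ Eg P t * (Zp P i s * xi P i j r) ∈ NN P r S := by
  have hjump : ∀ i' c, i < i' → i' ≤ r → c ∈ Bsub P (r - 1) →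
      Zp P i s * (xi P i' i' r * c) ∈ NN P r S := by
    intro i' c h h' hc
    simpa using mul_gen_mem_NN (by omega) le_rfl h' hr (h2 i' h h') (Zp_mem_Low hi h s) hc
  have hgen : ∀ j', i ≤ j' → j' ≤ r → Zp P i s * xi P i j' r ∈ NN P r S :=
    fun j' h h' => gen_mem_NN hi h h' h1
  rw [(X_commute_Zp_of_lt hi hit s).left_comm, (E_commute_Zp_of_lt hi hit s).left_comm]
  rcases lt_trichotomy t j with h | rfl | h
  · rw [X_mul_xi_of_lt_of_lt hi hjr hr hit h, E_mul_xi_of_lt_of_lt hi hjr hr hit h]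
    exact ⟨gen_mul_mem_NN hi hij hjr h1 (X_mem_Bsub (by omega) (by omega)),
      gen_mul_mem_NN hi hij hjr h1 (E_mem_Bsub (by omega) (by omega))⟩
  · obtain ⟨m, rfl⟩ := Nat.exists_eq_add_of_le' (show 1 ≤ t by omega)
    rw [X_mul_xi_succ hi (by omega) hjr hr, E_mul_xi_succ hi (by omega) hjr hr, mul_smul_comm]
    exact ⟨hgen m (by omega) (by omega),
      Submodule.smul_mem _ _ (hjump _ _ hit htr (Xs_mem_Bsub hi (by omega)))⟩
  · rcases Nat.eq_or_lt_of_le (Nat.succ_le_of_lt h) with rfl | h'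
    · have hE : Zp P i s * (Eg P (j + 1) * xi P i j r) ∈ NN P r S := by
        rw [E_succ_mul_xi hi hij htr hr]
        exact hjump _ _ hit htr (Xs_mem_Bsub hi (by omega))
      refine ⟨?_, hE⟩
      rw [← (X_commute_Zp_of_lt hi hit s).left_comm]
      refine X_mul_mem_of (by omega) (by omega) ?_ (hgen j hij hjr) ?_
      · rw [← (commute_Xi_right (X_commute_Zp_of_lt hi hit s).symm).left_comm,
          Xi_mul_xi_eq_succ hi hij htr hr]
        exact hgen _ (by omega) htr
      · rwa [(E_commute_Zp_of_lt hi hit s).left_comm]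
    · obtain ⟨m, rfl⟩ := Nat.exists_eq_add_of_le' (show 2 ≤ t by omega)
      rw [X_mul_xi_of_gt hi hij hr (by omega) htr, E_mul_xi_of_gt hi hij hr (by omega) htr]
      exact ⟨gen_mul_mem_NN hi hij hjr h1 (X_mem_Bsub (by omega) (by omega)),
        gen_mul_mem_NN hi hij hjr h1 (E_mem_Bsub (by omega) (by omega))⟩

theorem Zp_succ_mul_E_mul {i : ℕ} (hi : 1 ≤ i) (hn : i < P.n) (a : ℤ) (x : Alg P) :
    Zp P (i + 1) a * (Eg P i * x) = Zp P i (-a) * (Eg P i * x) := by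
  rw [mul_assoc_of_eq (Zp_succ_mul_E hi hn a), mul_assoc]

theorem E_mul_Zp_succ_mul {i : ℕ} (hi : 1 ≤ i) (hn : i < P.n) (a : ℤ) (x : Alg P) :
    Eg P i * (Zp P (i + 1) a * x) = Eg P i * (Zp P i (-a) * x) := by
  rw [mul_assoc_of_eq (E_mul_Zp_succ hi hn a), mul_assoc]

theorem E_mul_xi_of_lt' {i j r : ℕ} (hi : 1 ≤ i) (hij : i < j) (hjr : j ≤ r) (hr : r < P.n) :
    ∃ c ∈ Bsub P (r - 1), Eg P i * xi P (i + 1) j r = xi P i i r * c := by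
  obtain ⟨d, hd, h⟩ := E_mul_xi_of_lt hi hij hjr hr
  rw [h]
  exact Gen_mul_xi_self hi hr hd

/-- The elements `ξ_{iir} c` with `c ∈ B_{r-1}`. -/
def xiB (P : Params R) (i r : ℕ) : Submodule R (Alg P) :=
  (Subalgebra.toSubmodule (Bsub P (r - 1))).map (LinearMap.mulLeft R (xi P i i r))

theorem mem_xiB {i r : ℕ} {x : Alg P} :
    x ∈ xiB P i r ↔ ∃ c ∈ Bsub P (r - 1), xi P i i r * c = x := by simp [xiB]

theorem mul_mem_xiB_right {i r : ℕ} {x c : Alg P} (hx : x ∈ xiB P i r)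
    (hc : c ∈ Bsub P (r - 1)) : x * c ∈ xiB P i r := by
  obtain ⟨d, hd, rfl⟩ := mem_xiB.1 hx
  exact mem_xiB.2 ⟨d * c, mul_mem hd hc, (mul_assoc _ _ _).symm⟩

theorem mul_mem_xiB_left {i r : ℕ} (hir : i ≤ r) {x z : Alg P} (hx : x ∈ xiB P i r)
    (hz : z ∈ Low P i) : z * x ∈ xiB P i r := by
  obtain ⟨d, hd, rfl⟩ := mem_xiB.1 hx
  exact mem_xiB.2 ⟨z * d, mul_mem (Low_le_Bsub (by omega) hz) hd,
    ((Low_commute_xi le_rfl hz).left_comm d).symm⟩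

theorem Zp_mul_mem_NN_of_mem_xiB {i r : ℕ} {s : ℤ} {S : ℕ → ℤ → Prop} (hi : 1 ≤ i) (hir : i ≤ r)
    (hS : S i s) {x : Alg P} (hx : x ∈ xiB P i r) : Zp P i s * x ∈ NN P r S := by
  obtain ⟨d, hd, rfl⟩ := mem_xiB.1 hx
  exact gen_mul_mem_NN hi le_rfl hir hS hd

theorem E_mul_xi_mem_xiB {i j r : ℕ} (hi : 1 ≤ i) (hij : i < j) (hjr : j ≤ r) (hr : r < P.n) :
    Eg P i * xi P (i + 1) j r ∈ xiB P i r := by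
  obtain ⟨c, hc, h⟩ := E_mul_xi_of_lt' hi hij hjr hr
  exact mem_xiB.2 ⟨c, hc, h.symm⟩

theorem E_mul_Zp_mul_xi_succ_mem {i j r : ℕ} (hi : 1 ≤ i) (hij : i < j) (hjr : j ≤ r)
    (hr : r < P.n) (a : ℤ) : Eg P i * (Zp P i a * xi P (i + 1) j r) ∈ xiB P i r := by
  rw [(Low_commute_xi hij (Zp_mem_Low hi (Nat.lt_succ_self i) a)).eq, ← mul_assoc]
  exact mul_mem_xiB_right (E_mul_xi_mem_xiB hi hij hjr hr) (Zp_mem_Bsub hi (by omega) a)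

theorem E_mul_Zp_mul_xi_mem (hk : 1 ≤ P.k) (hq0 : P.qc 0 = (P.q0 : R)) {i j r : ℕ} (hi : 1 ≤ i)
    (hij : i ≤ j) (hjr : j ≤ r) (hr : r < P.n) (s : ℤ) :
    Eg P i * (Zp P i s * xi P i j r) ∈ xiB P i r := by
  have hn : i < P.n := by omega
  rcases Nat.eq_or_lt_of_le hij with rfl | hij
  · obtain ⟨z, hz, h⟩ := E_Zp_E hk hq0 hi hn s
    rw [xi_self, Es_left hjr, h, ← Es_left hjr, ← xi_self]
    exact mul_mem_xiB_left hjr (mem_xiB.2 ⟨1, one_mem _, mul_one _⟩) hz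
  · have hcomm := Zp_commute_Zp (P := P) hi hn.le (show 1 ≤ i + 1 by omega) hn
    rw [xi_left hij]
    refine mem_of_sub_mem (pass_right_sub hi hn _ s _ (fun a _ => ?_) fun a _ => ?_) ?_
    · rw [(hcomm _ _).left_comm, E_mul_Zp_succ_mul hi hn, Zp_mul_Zp_mul]
      exact E_mul_Zp_mul_xi_succ_mem hi hij hjr hr _
    · obtain ⟨z, hz, h⟩ := E_Zp_E hk hq0 hi hn (s - a)
      rw [h, E_mul_Zp_succ_mul hi hn]
      exact mul_mem_xiB_left (by omega) (E_mul_Zp_mul_xi_succ_mem hi hij hjr hr _) hz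
    · rw [mul_assoc_of_eq (E_mul_X i), smul_mul_assoc, E_mul_Zp_succ_mul hi hn]
      exact Submodule.smul_mem _ _ (E_mul_Zp_mul_xi_succ_mem hi hij hjr hr _)

theorem E_pred_mul_mem {i j r : ℕ} (hi : 1 ≤ i) (hij : i < j) (hjr : j ≤ r) (hr : r < P.n)
    (s : ℤ) : Eg P i * (Zp P (i + 1) s * xi P (i + 1) j r) ∈ xiB P i r := by
  rw [E_mul_Zp_succ_mul hi (by omega)]
  exact E_mul_Zp_mul_xi_succ_mem hi hij hjr hr _

theorem X_pred_mul_mem_NN {i j r : ℕ} (hi : 1 ≤ i) (hij : i < j) (hjr : j ≤ r) (hr : r < P.n)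
    {s : ℤ} {S : ℕ → ℤ → Prop} (h1 : S i s) (h2 : ∀ a, Bt s a → S (i + 1) a)
    (h3 : ∀ a, Bt s a → S i (s - a)) :
    Xg P i * (Zp P (i + 1) s * xi P (i + 1) j r) ∈ NN P r S := by
  have hn : i < P.n := by omega
  have h := pass_right_sub (N := NN P r S) hi hn 1 s (xi P (i + 1) j r)
    (fun a ha => by
      rw [one_mul]
      simpa using mul_gen_mem_NN (by omega) hij hjr hr (h2 a ha)
        (Zp_mem_Low hi (Nat.lt_succ_self i) (s - a)) (one_mem _))
    (fun a ha => by
      rw [one_mul]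
      exact Zp_mul_mem_NN_of_mem_xiB hi (by omega) (h3 a ha) (E_pred_mul_mem hi hij hjr hr a))
  rw [one_mul, one_mul, ← xi_left hij] at h
  exact mem_of_sub_mem' h (gen_mem_NN hi hij.le hjr h1)

theorem Zp_succ_mul_Zp_mul_xi_mem_NN {i j r : ℕ} (hi : 1 ≤ i) (hij : i < j) (hjr : j ≤ r)
    (hr : r < P.n) {a b : ℤ} {S : ℕ → ℤ → Prop} (h1 : S i b) (h2 : ∀ c, Bt a c → S (i + 1) c)
    (h3 : ∀ c, Bt a c → S i (b - c)) :
    Zp P (i + 1) a * (Zp P i b * xi P i j r) ∈ NN P r S := by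
  have hn : i < P.n := by omega
  have hcomm := Zp_commute_Zp (P := P) hi hn.le (show 1 ≤ i + 1 by omega) hn
  have hlow : ∀ b, Zp P i b ∈ Low P (i + 1) := Zp_mem_Low hi (Nat.lt_succ_self i)
  rw [← (hcomm _ _).left_comm, xi_left hij]
  refine mem_of_sub_mem' (pass_left_sub hi hn _ a _ (fun c hc => ?_) fun c hc => ?_) ?_
  · rw [← (hcomm _ _).left_comm, Zp_mul_Zp_mul]
    simpa using mul_gen_mem_NN (by omega) hij hjr hr (h2 c hc) (hlow (b + (a - c))) (one_mem _)
  · rw [Zp_succ_mul_E_mul hi hn, Zp_mul_Zp_mul]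
    exact Zp_mul_mem_NN_of_mem_xiB hi (by omega) (by simpa [sub_eq_add_neg] using h3 c hc)
      (E_mul_Zp_mul_xi_succ_mem hi hij hjr hr _)
  · rw [(Low_commute_xi hij (hlow a)).eq, ← mul_assoc (Xg P i), ← xi_left hij]
    exact gen_mul_mem_NN hi hij.le hjr h1 (Zp_mem_Bsub hi (by omega) a)

theorem X_mul_Zp_mul_xi_self_mem_NN (hk : 1 ≤ P.k) (hq0 : P.qc 0 = (P.q0 : R)) {i r : ℕ}
    (hi : 1 ≤ i) (hir : i ≤ r) (hr : r < P.n) {s : ℤ} {S : ℕ → ℤ → Prop} (h1 : S i (-s))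
    (h2 : ∀ a, Bt s a → S i (s - 2 * a)) (h3 : ∀ a, Bt s a → S i (-a)) :
    Xg P i * (Zp P i s * xi P i i r) ∈ NN P r S := by
  have hn : i < P.n := by omega
  have hcomm := Zp_commute_Zp (P := P) hi hn.le (show 1 ≤ i + 1 by omega) hn
  have h := pass_left_sub (N := NN P r S) hi hn (xi P i i r) s 1
    (fun a ha => by
      rw [one_mul, ← (hcomm _ _).left_comm, xi_self, Es_left hir, Zp_succ_mul_E_mul hi hn,
        ← Es_left hir, ← xi_self, Zp_mul_Zp_mul]
      exact gen_mem_NN hi le_rfl hir (by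
        rw [show s - a + -a = s - 2 * a by ring]; exact h2 a ha))
    (fun a ha => by
      rw [one_mul, Zp_succ_mul_E_mul hi hn]
      exact Zp_mul_mem_NN_of_mem_xiB hi hir (h3 a ha)
        (E_mul_Zp_mul_xi_mem hk hq0 hi le_rfl hir hr _))
  rw [one_mul, one_mul] at h
  refine mem_of_sub_mem h ?_
  rw [xi_self, Es_left hir, mul_assoc_of_eq (X_mul_E i), smul_mul_assoc, mul_smul_comm,
    Zp_succ_mul_E_mul hi hn, ← Es_left hir, ← xi_self]
  exact Submodule.smul_mem _ _ (gen_mem_NN hi le_rfl hir h1)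

theorem X_mul_Zp_mul_xi_sub_mem_NN (hk : 1 ≤ P.k) (hq0 : P.qc 0 = (P.q0 : R)) {i j r : ℕ}
    (hi : 1 ≤ i) (hij : i < j) (hjr : j ≤ r) (hr : r < P.n) {s : ℤ} (hs : 1 ≤ s)
    {S : ℕ → ℤ → Prop} (hS : ∀ i' u, (i' = i ∨ i' = i + 1) → -s < u → u < s → S i' u) :
    Xg P i * (Zp P i s * xi P i j r) - Zp P (i + 1) s * xi P (i + 1) j r ∈ NN P r S := by
  have hn : i < P.n := by omega
  have h := pass_both_sub (N := NN P r S) hi hn 1 (xi P (i + 1) j r) s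
    (fun a ha => by
      unfold Bt at ha
      rw [one_mul, ← xi_left hij]
      exact Zp_succ_mul_Zp_mul_xi_mem_NN hi hij hjr hr (hS _ _ (by omega) (by omega) (by omega))
        (fun c hc => by unfold Bt at hc; exact hS _ _ (by omega) (by omega) (by omega))
        (fun c hc => by unfold Bt at hc; exact hS _ _ (by omega) (by omega) (by omega)))
    (fun a ha => by
      unfold Bt at ha
      rw [one_mul, Zp_succ_mul_E_mul hi hn, ← xi_left hij]
      exact Zp_mul_mem_NN_of_mem_xiB hi (by omega) (hS _ _ (by omega) (by omega) (by omega))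
        (E_mul_Zp_mul_xi_mem hk hq0 hi hij.le hjr hr _))
  rwa [one_mul, one_mul, ← xi_left hij] at h

theorem X_mul_xi_mem_NN {i j r : ℕ} (hi : 1 ≤ i) (hij : i < j) (hjr : j ≤ r) (hr : r < P.n)
    {S : ℕ → ℤ → Prop} (h1 : S i 0) (h2 : S (i + 1) 0) : Xg P i * xi P i j r ∈ NN P r S := by
  have h : ∀ i' c, 1 ≤ i' → i' ≤ j → S i' 0 → c ∈ Bsub P (r - 1) →
      xi P i' j r * c ∈ NN P r S := fun i' c ha hb hS hc => by
    simpa using gen_mul_mem_NN ha hb hjr hS hc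
  rw [xi_left hij, ← mul_assoc, X_mul_X hi (by omega)]
  simp only [add_mul, sub_mul, one_mul, smul_mul_assoc]
  rw [← xi_left hij]
  refine Submodule.sub_mem _ (Submodule.add_mem _ ?_ (Submodule.smul_mem _ _ ?_))
    (Submodule.smul_mem _ _ ?_)
  · simpa using h (i + 1) 1 (by omega) hij h2 (one_mem _)
  · simpa using h i 1 hi hij.le h1 (one_mem _)
  · simpa using Zp_mul_mem_NN_of_mem_xiB (s := 0) hi (by omega) h1
      (E_mul_xi_mem_xiB hi hij hjr hr)

theorem Xi_mul_Zp {i : ℕ} (hi : 1 ≤ i) (s : ℤ) (x : Alg P) :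
    Xgi P i * (Zp P i s * x) = Zp P (i + 1) (-1) * (Xg P i * (Zp P i (s + 1) * x)) := by
  rw [add_comm s 1, Zp_add, mul_assoc, mul_assoc_of_eq (X_mul_Zp_one hi), mul_assoc,
    Zp_mul_Zp_mul]
  simp

theorem Xi_mul_Zp_mul_xi_sub_mem_NN (hk : 1 ≤ P.k) (hq0 : P.qc 0 = (P.q0 : R)) {i j r : ℕ}
    (hi : 1 ≤ i) (hij : i < j) (hjr : j ≤ r) (hr : r < P.n) {s : ℤ} (hs : 1 ≤ s)
    {S : ℕ → ℤ → Prop} (hS : ∀ i' u, (i' = i ∨ i' = i + 1) → -s < u → u < s → S i' u)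
    (hS' : S i s) :
    Xgi P i * (Zp P i (-s) * xi P i j r) - Zp P (i + 1) (-s) * xi P (i + 1) j r ∈ NN P r S := by
  have hn : i < P.n := by omega
  rw [Xi_mul_Zp hi]
  have h := pass_left_sub (N := NN P r S) hi hn (xi P i j r) (-s + 1) (Zp P (i + 1) (-1))
    (fun a ha => by
      unfold Bt at ha
      rw [Zp_mul_Zp_mul]
      exact Zp_succ_mul_Zp_mul_xi_mem_NN hi hij hjr hr (hS _ _ (by omega) (by omega) (by omega))
        (fun c hc => by unfold Bt at hc; exact hS _ _ (by omega) (by omega) (by omega))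
        (fun c hc => by unfold Bt at hc; exact hS _ _ (by omega) (by omega) (by omega)))
    (fun a ha => by
      unfold Bt at ha
      rw [Zp_mul_Zp_mul, Zp_succ_mul_E_mul hi hn]
      exact Zp_mul_mem_NN_of_mem_xiB hi (by omega) (hS _ _ (by omega) (by omega) (by omega))
        (E_mul_Zp_mul_xi_mem hk hq0 hi hij.le hjr hr _))
  rw [Zp_mul_Zp_mul, neg_add_cancel_comm_assoc] at h
  have hX : Xg P i * xi P i j r = xi P (i + 1) j r + P.delta • xi P i j r
      - (P.delta * (P.lam : R)) • (Eg P i * xi P (i + 1) j r) := by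
    conv_lhs => rw [xi_left hij]
    rw [← mul_assoc, X_mul_X hi hn]
    simp only [add_mul, sub_mul, one_mul, smul_mul_assoc]
    rw [← xi_left hij]
  have h1 : Zp P (i + 1) (-s) * xi P i j r ∈ NN P r S := by
    have := Zp_succ_mul_Zp_mul_xi_mem_NN (P := P) (S := S) hi hij hjr hr (a := -s) (b := 0)
      (hS _ _ (by omega) (by omega) (by omega))
      (fun c hc => by unfold Bt at hc; exact hS _ _ (by omega) (by omega) (by omega))
      (fun c hc => by unfold Bt at hc; exact hS _ _ (by omega) (by omega) (by omega))
    simpa using this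
  have h2 : Zp P (i + 1) (-s) * (Eg P i * xi P (i + 1) j r) ∈ NN P r S := by
    rw [Zp_succ_mul_E_mul hi hn, neg_neg]
    exact Zp_mul_mem_NN_of_mem_xiB hi (by omega) hS' (E_mul_xi_mem_xiB hi hij hjr hr)
  rw [hX] at h
  have h3 := Submodule.sub_mem _ (Submodule.add_mem _ h (Submodule.smul_mem _ P.delta h1))
    (Submodule.smul_mem _ (P.delta * (P.lam : R)) h2)
  convert h3 using 1
  simp only [mul_add, mul_sub, mul_smul_comm]
  abel

/-- The span of the `α_{i'jr}^u` with `i ≤ i'` and `|u| ≤ b` is stable under `X_t` and `e_t` for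
`i ≤ t ≤ r`. -/
theorem XE_mul_mem_NN_of_bounded (hk : 1 ≤ P.k) (hq0 : P.qc 0 = (P.q0 : R)) {i r t : ℕ}
    (hi : 1 ≤ i) (hit : i ≤ t) (htr : t ≤ r) (hr : r < P.n) (b : ℤ) {x : Alg P}
    (hx : x ∈ NN P r fun i' u => i ≤ i' ∧ -b ≤ u ∧ u ≤ b) :
    (Xg P t * x ∈ NN P r fun i' u => i ≤ i' ∧ -b ≤ u ∧ u ≤ b) ∧
      (Eg P t * x ∈ NN P r fun i' u => i ≤ i' ∧ -b ≤ u ∧ u ≤ b) := by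
  have key : ∀ i' j u, 1 ≤ i' → i' ≤ j → j ≤ r → (i ≤ i' ∧ -b ≤ u ∧ u ≤ b) →
      (Xg P t * (Zp P i' u * xi P i' j r) ∈ NN P r fun i' u => i ≤ i' ∧ -b ≤ u ∧ u ≤ b) ∧
      (Eg P t * (Zp P i' u * xi P i' j r) ∈ NN P r fun i' u => i ≤ i' ∧ -b ≤ u ∧ u ≤ b) := by
    intro i' j u hi' hij hjr hu
    rcases lt_trichotomy i' t with h | rfl | h
    · exact XE_mul_mem_NN_of_lt hi' hij hjr hr h htr hu (fun _ _ _ => by omega)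
    · have hE : Eg P i' * (Zp P i' u * xi P i' j r) ∈
          NN P r fun i' u => i ≤ i' ∧ -b ≤ u ∧ u ≤ b := by
        simpa using Zp_mul_mem_NN_of_mem_xiB (S := fun i' u => i ≤ i' ∧ -b ≤ u ∧ u ≤ b) (s := 0)
          hi' (by omega) (by omega) (E_mul_Zp_mul_xi_mem hk hq0 hi' hij hjr hr u)
      refine ⟨?_, hE⟩
      rcases Nat.eq_or_lt_of_le hij with rfl | hij
      · exact X_mul_Zp_mul_xi_self_mem_NN hk hq0 hi' hjr hr (by omega)
          (fun a ha => by unfold Bt at ha; omega) (fun a ha => by unfold Bt at ha; omega)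
      rcases lt_trichotomy u 0 with h | rfl | h
      · refine X_mul_mem_of hi' (by omega) ?_ (gen_mem_NN hi' hij.le hjr hu) hE
        have := Xi_mul_Zp_mul_xi_sub_mem_NN (S := fun i' u => i ≤ i' ∧ -b ≤ u ∧ u ≤ b) hk hq0 hi'
          hij hjr hr (s := -u) (by omega) (fun _ _ _ _ _ => by omega) (by omega)
        rw [neg_neg] at this
        exact mem_of_sub_mem this (gen_mem_NN (by omega) hij hjr (by omega))
      · rw [Zp_zero, one_mul]
        exact X_mul_xi_mem_NN hi' hij hjr hr (by omega) (by omega)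
      · exact mem_of_sub_mem (X_mul_Zp_mul_xi_sub_mem_NN hk hq0 hi' hij hjr hr (by omega)
          (fun _ _ _ _ _ => by omega)) (gen_mem_NN (by omega) hij hjr (by omega))
    · rcases Nat.eq_or_lt_of_le (Nat.succ_le_of_lt h) with rfl | h
      · refine ⟨X_pred_mul_mem_NN (by omega) hij hjr hr (by omega)
          (fun a ha => by unfold Bt at ha; omega) (fun a ha => by unfold Bt at ha; omega), ?_⟩
        simpa using Zp_mul_mem_NN_of_mem_xiB (S := fun i' u => i ≤ i' ∧ -b ≤ u ∧ u ≤ b) (s := 0)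
          (by omega) (by omega) (by omega) (E_pred_mul_mem (by omega) hij hjr hr u)
      · have hX : Xg P t ∈ Low P i' := Bsub_le_Low (l := t + 1) (by omega) (by omega)
          (X_mem_Bsub (by omega) le_rfl)
        have hE : Eg P t ∈ Low P i' := Bsub_le_Low (l := t + 1) (by omega) (by omega)
          (E_mem_Bsub (by omega) le_rfl)
        exact ⟨by simpa using mul_gen_mem_NN hi' hij hjr hr hu hX (one_mem _),
          by simpa using mul_gen_mem_NN hi' hij hjr hr hu hE (one_mem _)⟩
  exact ⟨mul_mem_NN_left (fun i' j u h1 h2 h3 h4 => (key i' j u h1 h2 h3 h4).1) hx,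
    mul_mem_NN_left (fun i' j u h1 h2 h3 h4 => (key i' j u h1 h2 h3 h4).2) hx⟩

theorem Gen_mul_mem_NN (hk : 1 ≤ P.k) (hq0 : P.qc 0 = (P.q0 : R)) {i r : ℕ}
    (hi : 1 ≤ i) (hr : r < P.n) (b : ℤ) {x d : Alg P} (hd : d ∈ Gen P i r)
    (hx : x ∈ NN P r fun i' u => i ≤ i' ∧ -b ≤ u ∧ u ≤ b) :
    d * x ∈ NN P r fun i' u => i ≤ i' ∧ -b ≤ u ∧ u ≤ b := by
  refine mul_mem_of_mem_adjoin ?_ hd x hx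
  rintro g ⟨t, h1, h2, rfl | rfl⟩ x hx
  · exact (XE_mul_mem_NN_of_bounded hk hq0 hi h1 h2 hr b hx).1
  · exact (XE_mul_mem_NN_of_bounded hk hq0 hi h1 h2 hr b hx).2

/-! ### Reduction of exponents -/

theorem Zp_mul_xi_mem_of_pos (hk : 1 ≤ P.k) (hq0 : P.qc 0 = (P.q0 : R)) {r : ℕ} (hr : r < P.n)
    {p : ℤ} (hp : (P.k : ℤ) < 2 * p) {i j : ℕ} (hi : 1 ≤ i) (hij : i ≤ j) (hjr : j ≤ r) :
    Zp P i p * xi P i j r ∈ NN P r fun i' u => 1 ≤ i' ∧ -(p - 1) ≤ u ∧ u ≤ p - 1 := by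
  induction i, hi using Nat.le_induction with
  | base =>
    have := Zp_one_mem_of_lower (P := P)
      (NN P r fun i' u => 1 ≤ i' ∧ -(p - 1) ≤ u ∧ u ≤ p - 1) 1 (xi P 1 j r) p
      (fun s h1 h2 => by rw [one_mul]; exact gen_mem_NN le_rfl hij hjr (by omega))
    rwa [one_mul] at this
  | succ i hi ih =>
    exact mem_of_sub_mem' (X_mul_Zp_mul_xi_sub_mem_NN hk hq0 hi hij hjr hr (by omega)
      (fun _ _ _ _ _ => by omega))
      (XE_mul_mem_NN_of_bounded hk hq0 le_rfl hi (by omega) hr _ (ih (by omega))).1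

/-- The exponents produced when rewriting `(Y_i')^{-s}`. -/
def NegExp (s : ℤ) (i : ℕ) : ℕ → ℤ → Prop := fun i' u => (i' ≤ i ∧ u = s) ∨ (-s < u ∧ u < s)

theorem Xi_mul_mem_NegExp (hk : 1 ≤ P.k) (hq0 : P.qc 0 = (P.q0 : R)) {r : ℕ} (hr : r < P.n)
    {s : ℤ} (hs : 1 ≤ s) {i : ℕ} (hi : 1 ≤ i) (hir : i < r)
    (hyp : ∀ j, i ≤ j → j ≤ r → Zp P i (-s) * xi P i j r ∈ NN P r (NegExp s i)) {x : Alg P}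
    (hx : x ∈ NN P r (NegExp s i)) : Xgi P i * x ∈ NN P r (NegExp s (i + 1)) := by
  have mono : NN P r (NegExp s i) ≤ NN P r (NegExp s (i + 1)) :=
    NN_mono fun _ _ _ _ h => h.imp (fun h => ⟨by omega, h.2⟩) id
  suffices h : ∀ i' j u, 1 ≤ i' → i' ≤ j → j ≤ r → NegExp s i i' u →
      Xg P i * (Zp P i' u * xi P i' j r) ∈ NN P r (NegExp s (i + 1)) ∧
      Eg P i * (Zp P i' u * xi P i' j r) ∈ NN P r (NegExp s (i + 1)) from
    Xi_mul_mem_of hi (by omega) (mul_mem_NN_left (fun i' j u h1 h2 h3 h4 => (h _ _ _ h1 h2 h3 h4).1) hx)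
      (mono hx) (mul_mem_NN_left (fun i' j u h1 h2 h3 h4 => (h _ _ _ h1 h2 h3 h4).2) hx)
  rintro i' j u hi' hij hjr (⟨hle, rfl⟩ | hu)
  · rcases Nat.lt_or_eq_of_le hle with hlt | rfl
    · exact XE_mul_mem_NN_of_lt hi' hij hjr hr hlt hir.le (Or.inl ⟨by omega, rfl⟩)
        (fun _ _ _ => Or.inr (by omega))
    have hE : Eg P i' * (Zp P i' u * xi P i' j r) ∈ NN P r (NegExp u (i' + 1)) := by
      simpa using Zp_mul_mem_NN_of_mem_xiB (S := NegExp u (i' + 1)) (s := 0)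
        hi' hir.le (Or.inr (by omega)) (E_mul_Zp_mul_xi_mem hk hq0 hi' hij hjr hr u)
    refine ⟨?_, hE⟩
    rcases Nat.eq_or_lt_of_le hij with rfl | hij
    · have h := X_mul_Zp_mul_xi_self_mem_NN (s := u)
        (S := fun i'' v => NegExp u (i' + 1) i'' v ∨ (i'' = i' ∧ v = -u)) hk hq0 hi' hjr hr
        (Or.inr ⟨rfl, rfl⟩)
        (fun a ha => by unfold Bt at ha; unfold NegExp; omega)
        (fun a ha => by unfold Bt at ha; unfold NegExp; omega)
      refine NN_le (fun i'' j v c h1 h2 h3 hv hc => ?_) h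
      rcases hv with hv | ⟨rfl, rfl⟩
      · exact gen_mul_mem_NN h1 h2 h3 hv hc
      · rw [← mul_assoc]
        exact mul_mem_NN_right (mono (hyp _ h2 h3)) hc
    · exact mem_of_sub_mem (X_mul_Zp_mul_xi_sub_mem_NN hk hq0 hi' hij hjr hr hs
        (fun _ _ _ h1 h2 => Or.inr ⟨h1, h2⟩)) (gen_mem_NN (by omega) hij hjr (Or.inl ⟨le_rfl, rfl⟩))
  · have hm : (NN P r fun i' v => 1 ≤ i' ∧ -(s - 1) ≤ v ∧ v ≤ s - 1) ≤
        NN P r (NegExp s (i + 1)) := NN_mono fun _ _ _ _ h => Or.inr (by omega)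
    have := XE_mul_mem_NN_of_bounded hk hq0 le_rfl hi hir.le hr (s - 1)
      (gen_mem_NN (P := P) (S := fun i' v => 1 ≤ i' ∧ -(s - 1) ≤ v ∧ v ≤ s - 1) hi' hij hjr
        (s := u) (by omega))
    exact ⟨hm this.1, hm this.2⟩

theorem Zp_mul_xi_mem_of_neg (hk : 1 ≤ P.k) (hq0 : P.qc 0 = (P.q0 : R)) {r : ℕ} (hr : r < P.n)
    {s : ℤ} (hs : (P.k : ℤ) ≤ 2 * s) {i j : ℕ} (hi : 1 ≤ i) (hij : i ≤ j) (hjr : j ≤ r) :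
    Zp P i (-s) * xi P i j r ∈ NN P r (NegExp s i) := by
  induction i, hi using Nat.le_induction generalizing j with
  | base =>
    have := Zp_one_mem_of_upper (P := P) hk hq0 (NN P r (NegExp s 1)) 1 (xi P 1 j r) (-s)
      (fun t h1 h2 => by
        rw [one_mul]; exact gen_mem_NN le_rfl hij hjr (by unfold NegExp; omega))
    rwa [one_mul] at this
  | succ i hi ih =>
    exact mem_of_sub_mem' (Xi_mul_Zp_mul_xi_sub_mem_NN hk hq0 hi hij hjr hr (by omega)
      (fun _ _ _ h1 h2 => Or.inr ⟨h1, h2⟩) (Or.inl ⟨by omega, rfl⟩))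
      (Xi_mul_mem_NegExp hk hq0 hr (by omega) hi (by omega) (fun _ h h' => ih h h')
        (ih (by omega) hjr))

/-- The right `B_{r-1}`-submodule spanned by the `α_{ijr}^s` with `s ∈ P`. -/
abbrev NP (P : Params R) (r : ℕ) : Submodule R (Alg P) := NN P r fun _ s => s ∈ Pset P.k

theorem NN_le_NP (hk : 1 ≤ P.k) (hq0 : P.qc 0 = (P.q0 : R)) {r : ℕ} (hr : r < P.n)
    (S : ℕ → ℤ → Prop) : NN P r S ≤ NP P r := by
  have hb : ∀ b : ℕ, (NN P r fun i' u => 1 ≤ i' ∧ -(b : ℤ) ≤ u ∧ u ≤ b) ≤ NP P r := by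
    intro b
    induction b with
    | zero => exact NN_mono fun _ _ _ _ h => ⟨by omega, by omega⟩
    | succ b ih =>
      have hpos : ∀ i j, 1 ≤ i → i ≤ j → j ≤ r → Zp P i (b + 1) * xi P i j r ∈ NP P r := by
        intro i j hi hij hjr
        by_cases hP : ((b : ℤ) + 1) ∈ Pset P.k
        · exact gen_mem_NN hi hij hjr hP
        · refine ih ?_
          have := Zp_mul_xi_mem_of_pos hk hq0 hr (p := b + 1)
            (by simp only [Pset, Set.mem_ofPred_eq] at hP; omega) hi hij hjr
          rwa [add_sub_cancel_right] at this
      refine NN_le fun i j u c hi hij hjr hu hc => ?_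
      rw [← mul_assoc]
      refine mul_mem_NN_right ?_ hc
      by_cases h1 : u = b + 1
      · exact h1 ▸ hpos i j hi hij hjr
      by_cases hP : u ∈ Pset P.k
      · exact gen_mem_NN hi hij hjr hP
      by_cases h2 : u = -(b + 1)
      · subst h2
        refine NN_le (fun i' j' v d hi' hij' hjr' hv hd => ?_)
          (Zp_mul_xi_mem_of_neg hk hq0 hr (s := b + 1)
            (by simp only [Pset, Set.mem_ofPred_eq] at hP; omega) hi hij hjr)
        rw [← mul_assoc]
        refine mul_mem_NN_right ?_ hd
        rcases hv with ⟨-, rfl⟩ | hv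
        · exact hpos i' j' hi' hij' hjr'
        · exact ih (gen_mem_NN hi' hij' hjr' (by omega))
      · exact ih (gen_mem_NN hi hij hjr (by push_cast at hu; omega))
  refine NN_le fun i j u c hi hij hjr _ hc => hb u.natAbs ?_
  exact gen_mul_mem_NN hi hij hjr (by omega) hc

theorem Ygi_eq : Ygi P = Zp P 1 (-1) := by
  have h : Yg P * Zp P 1 (-1) = 1 := by
    rw [← Yp_one, ← Zp_one, Zp_mul_Zp]; simp
  rw [← one_mul (Zp P 1 (-1)), ← Yi_mul_Y, mul_assoc, h, mul_one]

theorem Bsub_mul_mem_NP (hk : 1 ≤ P.k) (hq0 : P.qc 0 = (P.q0 : R)) {r : ℕ} (hr : r < P.n)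
    {x y : Alg P} (hy : y ∈ Bsub P (r + 1)) (hx : x ∈ NP P r) : y * x ∈ NP P r := by
  have hle := NN_le_NP (P := P) hk hq0 hr
  have hY : ∀ a : ℤ, ∀ i j s, 1 ≤ i → i ≤ j → j ≤ r → s ∈ Pset P.k →
      Zp P 1 a * (Zp P i s * xi P i j r) ∈ NP P r := by
    intro a i j s hi hij hjr hs
    rcases Nat.eq_or_lt_of_le hi with rfl | hi'
    · rw [Zp_mul_Zp_mul]
      exact hle (fun _ _ => True) (gen_mem_NN hi hij hjr trivial)
    · simpa using mul_gen_mem_NN (S := fun _ s => s ∈ Pset P.k) hi hij hjr hr hs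
        (Zp_mem_Low le_rfl hi' a) (one_mem _)
  have hXE : ∀ t, 1 ≤ t → t ≤ r → ∀ i j s, 1 ≤ i → i ≤ j → j ≤ r → s ∈ Pset P.k →
      Xg P t * (Zp P i s * xi P i j r) ∈ NP P r ∧ Eg P t * (Zp P i s * xi P i j r) ∈ NP P r := by
    intro t h1 h2 i j s hi hij hjr _
    have := XE_mul_mem_NN_of_bounded hk hq0 le_rfl h1 h2 hr s.natAbs
      (gen_mem_NN (P := P) (S := fun i' u => 1 ≤ i' ∧ -(s.natAbs : ℤ) ≤ u ∧ u ≤ s.natAbs)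
        hi hij hjr (s := s) (by omega))
    exact ⟨hle _ this.1, hle _ this.2⟩
  refine mul_mem_of_mem_adjoin ?_ hy x hx
  rintro g (hg | ⟨t, h1, h2, hg⟩) x hx
  · rcases hg with rfl | rfl
    · rw [← Yp_one, ← Zp_one]
      exact mul_mem_NN_left (hY 1) hx
    · rw [Ygi_eq]
      exact mul_mem_NN_left (hY (-1)) hx
  · have hX := mul_mem_NN_left (fun i j s a b c d => (hXE t h1 (by omega) i j s a b c d).1) hx
    have hE := mul_mem_NN_left (fun i j s a b c d => (hXE t h1 (by omega) i j s a b c d).2) hx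
    rcases hg with rfl | rfl | rfl
    · exact hX
    · exact Xi_mul_mem_of h1 (by omega) hX hx hE
    · exact hE

theorem Bsub_mul_E_mem_NP (hk : 1 ≤ P.k) (hq0 : P.qc 0 = (P.q0 : R)) {r : ℕ} (h1 : 1 ≤ r)
    (hr : r < P.n) {y : Alg P} (hy : y ∈ Bsub P (r + 1)) : y * Eg P r ∈ NP P r := by
  refine Bsub_mul_mem_NP hk hq0 hr hy (NN_le_NP hk hq0 hr (fun _ _ => True) ?_)
  have := gen_mem_NN (P := P) (S := fun _ _ => True) h1 le_rfl le_rfl (s := 0) trivial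
  rwa [Zp_zero, one_mul, xi_self, Es_left le_rfl, Es_of_lt (Nat.lt_succ_self r), mul_one] at this

/-! ### Products of two consecutive `α`s -/

theorem Es_mul_Es_of_add_two_le {a j q : ℕ} (hja : j + 2 ≤ a) (haq : a ≤ q + 2)
    (hq : q + 2 < P.n) : Es P a (q + 2) * Es P j (q + 2) = Es P a (q + 2) * Es P j q := by
  have hc : Commute (Eg P (q + 2)) (Es P j q) := commute_Es fun t _ _ => EE_far (by omega)
  rw [Es_right (r := q + 1) haq, mul_assoc, mul_assoc, Es_right (r := q + 1) (j := j) (by omega),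
    Es_right (r := q) (j := j) (by omega), mul_assoc (Es P j q), hc.left_comm,
    E_E_E (by omega) hq (by omega) (by omega) (by omega), ← hc.eq]

theorem xi_mul_xi {i j i' j' q : ℕ} (hi : 1 ≤ i) (hij : i ≤ j) (hji : j ≤ i') (hij' : i' ≤ j')
    (hjq : j' ≤ q) (hq : q + 2 < P.n) :
    xi P i j (q + 2) * xi P i' j' q =
      xi P (i' + 2) (j' + 2) (q + 2) * (Xs P i j * Es P j q) := by
  have hX : ∀ j', i' ≤ j' → j' ≤ q + 1 →
      xi P i j (q + 2) * Xs P i' j' = Xs P (i' + 2) (j' + 2) * xi P i j (q + 2) := by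
    intro j' h
    induction j', h using Nat.le_induction with
    | base => simp
    | succ t ht ih =>
      intro h
      rw [Xs_right ht, mul_assoc_of_eq (ih (by omega)), mul_assoc,
        ← X_mul_xi_of_gt hi hij hq (by omega) (by omega), ← mul_assoc, ← Xs_right (by omega),
        Nat.add_right_comm]
  have hE : ∀ q', j' ≤ q' + 1 → q' ≤ q →
      xi P i j (q + 2) * Es P j' q' = Es P (j' + 2) (q' + 2) * xi P i j (q + 2) := by
    intro q' h
    obtain ⟨m, hm⟩ := Nat.exists_eq_add_of_le h
    induction m generalizing q' with
    | zero => intro _; rw [Es_of_lt (by omega), Es_of_lt (by omega), mul_one, one_mul]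
    | succ m ih =>
      intro h'
      obtain ⟨t, rfl⟩ := Nat.exists_eq_add_of_le' (show 1 ≤ q' by omega)
      rw [Es_right (by omega), mul_assoc_of_eq (ih t (by omega) (by omega) (by omega)), mul_assoc,
        ← E_mul_xi_of_gt hi hij hq (by omega) (by omega), ← mul_assoc, Nat.add_right_comm t 1 2,
        ← Es_right (by omega)]
  have hc : Commute (Es P (j' + 2) (q + 2)) (Xs P i j) :=
    commute_Xs fun t _ _ => Commute.symm <| commute_Es fun s _ _ => XE_far (by omega)
  rw [xi.eq_def P i' j' q, ← mul_assoc, hX j' hij' (by omega), mul_assoc, hE q (by omega) le_rfl,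
    xi.eq_def P i j, hc.left_comm, Es_mul_Es_of_add_two_le (by omega) (by omega) hq,
    ← hc.left_comm, ← mul_assoc, ← xi]

theorem xi_mul_Gen {i j q a : ℕ} (hi : 1 ≤ i) (hij : i ≤ j) (hia : i ≤ a) (haj : a < j)
    (hq : q + 2 < P.n) (hjq : j ≤ q + 2) {c : Alg P} (hc : c ∈ Gen P a (q - 1)) :
    ∃ d ∈ Gen P (a + 1) (q + 2), xi P i j (q + 2) * c = d * xi P i j (q + 2) := by
  induction hc using Algebra.adjoin_induction with
  | mem g hg =>
    obtain ⟨t, h1, h2, hg⟩ := hg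
    rcases Nat.lt_trichotomy (t + 1) j with h | h | h
    · rcases hg with rfl | rfl
      · exact ⟨_, X_mem_Gen (by omega) (by omega),
          (X_mul_xi_of_lt_of_lt (t := t + 1) hi hjq hq (by omega) h).symm⟩
      · exact ⟨_, E_mem_Gen (by omega) (by omega),
          (E_mul_xi_of_lt_of_lt (t := t + 1) hi hjq hq (by omega) h).symm⟩
    · subst h
      have key := X_mul_xi_succ (P := P) hi hij (show t + 1 + 1 ≤ q + 2 by omega) hq
      have key' := Xi_mul_xi_eq_succ (P := P) hi hij (show t + 1 + 1 ≤ q + 2 by omega) hq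
      have hXm : Xg P (t + 1 + 1) ∈ Gen P (a + 1) (q + 2) := X_mem_Gen (by omega) (by omega)
      have hXim : Xgi P (t + 1 + 1) ∈ Gen P (a + 1) (q + 2) :=
        Xi_mem_Gen (by omega) (by omega) (by omega) (by omega)
      rcases hg with rfl | rfl
      · refine ⟨Xg P (t + 1 + 1) * (Xg P (t + 1) * Xgi P (t + 1 + 1)),
          mul_mem hXm (mul_mem (X_mem_Gen (by omega) (by omega)) hXim), ?_⟩
        have := X_mul_xi_of_lt_of_lt (P := P) (i := i) (j := t + 1 + 1) (t := t + 1) hi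
          (by omega) hq (by omega) (by omega)
        rw [mul_assoc, mul_assoc, key', this, ← mul_assoc, key, Nat.add_sub_cancel]
      · refine ⟨Xg P (t + 1 + 1) * (Eg P (t + 1) * Xgi P (t + 1 + 1)),
          mul_mem hXm (mul_mem (E_mem_Gen (by omega) (by omega)) hXim), ?_⟩
        have := E_mul_xi_of_lt_of_lt (P := P) (i := i) (j := t + 1 + 1) (t := t + 1) hi
          (by omega) hq (by omega) (by omega)
        rw [mul_assoc, mul_assoc, key', this, ← mul_assoc, key, Nat.add_sub_cancel]
    · rcases hg with rfl | rfl
      · exact ⟨_, X_mem_Gen (by omega) (by omega),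
          (X_mul_xi_of_gt hi hij hq (by omega) (by omega)).symm⟩
      · exact ⟨_, E_mem_Gen (by omega) (by omega),
          (E_mul_xi_of_gt hi hij hq (by omega) (by omega)).symm⟩
  | algebraMap r => exact ⟨_, Subalgebra.algebraMap_mem _ r, (Algebra.commutes r _).symm⟩
  | add x y _ _ ihx ihy =>
    obtain ⟨d, hd, h⟩ := ihx
    obtain ⟨d', hd', h'⟩ := ihy
    exact ⟨d + d', add_mem hd hd', by rw [mul_add, h, h', add_mul]⟩
  | mul x y _ _ ihx ihy =>
    obtain ⟨d, hd, h⟩ := ihx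
    obtain ⟨d', hd', h'⟩ := ihy
    exact ⟨d * d', mul_mem hd hd', by rw [← mul_assoc, h, mul_assoc, h', mul_assoc]⟩

theorem Xs_mem_Gen {i j a b : ℕ} (hi : a ≤ i) (hj : j ≤ b + 1) : Xs P i j ∈ Gen P a b := by
  refine Subalgebra.list_prod_mem _ fun y hy => ?_
  obtain ⟨t, ht, rfl⟩ := List.mem_map.1 hy
  rw [List.mem_range'_1] at ht
  exact X_mem_Gen (by omega) (by omega)

theorem Es_mem_Gen {j r a b : ℕ} (hj : a ≤ j) (hr : r ≤ b) : Es P j r ∈ Gen P a b := by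
  refine Subalgebra.list_prod_mem _ fun y hy => ?_
  obtain ⟨t, ht, rfl⟩ := List.mem_map.1 hy
  rw [List.mem_range'_1] at ht
  exact E_mem_Gen (by omega) (by omega)

theorem xi_eq_Xs_mul_xi_self {i j r : ℕ} (hi : 1 ≤ i) (hij : i ≤ j) (hjr : j ≤ r) (hr : r < P.n) :
    xi P i j r = Xs P (j + 1) (r + 1) * xi P i r r := by
  obtain ⟨m, rfl⟩ := Nat.exists_eq_add_of_le hjr
  induction m generalizing j with
  | zero => simp
  | succ m ih =>
    rw [← X_mul_xi_succ hi hij (by omega) hr, show j + (m + 1) = j + 1 + m by omega,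
      ih (by omega) (by omega) (by omega), ← mul_assoc, ← Xs_left (by omega)]

theorem xi_mul_E {i q : ℕ} (hi : 1 ≤ i) (hiq : i ≤ q) (hq : q + 2 < P.n) :
    xi P i (q + 2) (q + 2) * Eg P q =
      xi P (q + 1) (q + 1) (q + 2) * Xs P i q * Eg P q := by
  have hE : Es P (q + 2) (q + 2) = Eg P (q + 2) := by
    rw [Es_left le_rfl, Es_of_lt (by omega), mul_one]
  have hc : Commute (Eg P (q + 2)) (Eg P q) := EE_far (by omega)
  have h1 : Commute (Eg P (q + 1)) (Xs P i q) :=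
    commute_Xs fun t _ _ => (XE_far (by omega)).symm
  have h2 : Commute (Eg P (q + 2)) (Xs P i q) :=
    commute_Xs fun t _ _ => (XE_far (by omega)).symm
  rw [xi, hE, Xs_right (by omega), Xs_right hiq, xi_self, Es_left (by omega), hE]
  simp only [mul_assoc]
  rw [hc.eq, ← mul_assoc (Xg P (q + 1)), mul_assoc_of_eq (X_X_E (by omega) (by omega) (by omega)
    (by omega) (by omega)), mul_assoc, ← hc.eq, ← h1.left_comm, ← h2.left_comm]

theorem Low_mul_mem_NN {i r : ℕ} (hr : r < P.n) {S : ℕ → ℤ → Prop} (hS : ∀ i' u, S i' u → i ≤ i')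
    {z x : Alg P} (hz : z ∈ Low P i) (hx : x ∈ NN P r S) : z * x ∈ NN P r S :=
  mul_mem_NN_left (fun i' j u h1 h2 h3 h4 => by
    simpa using mul_gen_mem_NN h1 h2 h3 hr h4 (Low_mono (hS _ _ h4) hz) (one_mem _)) hx

/-- The set `N e_q`, for `N` the span of the `α_{i,j,q+2}^u` with `i₁ < i` and `u ∈ P`. -/
def NE (P : Params R) (i₁ q : ℕ) : Submodule R (Alg P) :=
  (NN P (q + 2) fun i u => i₁ < i ∧ u ∈ Pset P.k).map (LinearMap.mulRight R (Eg P q))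

theorem mul_E_mem_NE {i₁ q : ℕ} {x : Alg P}
    (hx : x ∈ NN P (q + 2) fun i u => i₁ < i ∧ u ∈ Pset P.k) : x * Eg P q ∈ NE P i₁ q :=
  Submodule.mem_map_of_mem (f := LinearMap.mulRight R (Eg P q)) hx

theorem xi_eq_mul_E {i j q : ℕ} (hj : 1 ≤ j) (hjq : j ≤ q) :
    xi P i j q = Xs P i j * Es P j (q - 1) * Eg P q := by
  obtain ⟨m, rfl⟩ := Nat.exists_eq_add_of_le' (hj.trans hjq)
  rw [xi, Es_right hjq, mul_assoc, Nat.add_sub_cancel]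

theorem Xs_mul_Es_mem_Bsub {i j q : ℕ} (hi : 1 ≤ i) (hij : i ≤ j) (hjq : j ≤ q) :
    Xs P i j * Es P j (q - 1) ∈ Bsub P (q + 2 - 1) :=
  mul_mem (Xs_mem_Bsub hi (by omega)) (Es_mem_Bsub (hi.trans hij) (by omega))

theorem Zp_mul_xi_mul_mem_NE {i₁ j₁ i₂ j₂ q : ℕ} {s₂ : ℤ} (hi : 1 ≤ i₁) (hij : i₁ ≤ j₁)
    (hji : j₁ ≤ i₂) (hij₂ : i₂ ≤ j₂) (hjq : j₂ ≤ q) (hq : q + 2 < P.n) (hs : s₂ ∈ Pset P.k)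
    {z : Alg P} (hz : z ∈ Low P (i₂ + 2)) :
    z * (xi P i₁ j₁ (q + 2) * (Zp P i₂ s₂ * xi P i₂ j₂ q)) ∈ NE P i₁ q := by
  rw [mul_assoc_of_eq (xi_mul_Zp hi hij hq hji (by omega) s₂), mul_assoc,
    xi_mul_xi hi hij hji hij₂ hjq hq, ← xi, xi_eq_mul_E (hi.trans hij) (by omega)]
  simp only [← mul_assoc]
  simp only [mul_assoc (xi P (i₂ + 2) _ _), mul_assoc (Zp P (i₂ + 2) _), mul_assoc z]
  simp only [← mul_assoc (xi P (i₂ + 2) _ _), ← mul_assoc (Zp P (i₂ + 2) _), ← mul_assoc z]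
  refine mul_E_mem_NE ?_
  simp only [mul_assoc]
  exact mul_gen_mem_NN (by omega) (by omega) (by omega) hq ⟨by omega, hs⟩ hz
    (Xs_mul_Es_mem_Bsub hi hij (by omega))

theorem E_mul_xi_mul_mem_NN (hk : 1 ≤ P.k) (hq0 : P.qc 0 = (P.q0 : R)) {i j j' q : ℕ} {s b : ℤ}
    (hi : 1 ≤ i) (hij : i < j) (hjq : j ≤ q + 2) (hij' : i ≤ j') (hjq' : j' ≤ q) (hq : q + 2 < P.n)
    (hb : -b ≤ s) (hb' : s ≤ b) :
    ∃ x ∈ NN P (q + 2) fun i' u => i + 2 ≤ i' ∧ -b ≤ u ∧ u ≤ b,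
      Eg P i * (xi P (i + 1) j (q + 2) * (Zp P i s * xi P i j' q)) = x * Eg P q := by
  obtain ⟨d, hd, h⟩ := E_mul_xi_of_lt (P := P) hi hij hjq hq
  have hx := Gen_mul_mem_NN hk hq0 (show 1 ≤ i + 2 by omega) hq b hd
    (gen_mul_mem_NN (P := P) (i := i + 2) (j := j' + 2) (r := q + 2) (s := s)
      (S := fun i' u => i + 2 ≤ i' ∧ -b ≤ u ∧ u ≤ b) (by omega) (by omega) (by omega) (by omega)
      (Xs_mul_Es_mem_Bsub hi le_rfl (hij'.trans hjq')))
  refine ⟨_, hx, ?_⟩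
  rw [mul_assoc_of_eq h, mul_assoc, mul_assoc_of_eq (xi_mul_Zp hi le_rfl hq le_rfl (by omega) s),
    mul_assoc, xi_mul_xi hi le_rfl le_rfl hij' hjq' hq, ← xi, xi_eq_mul_E hi (by omega)]
  simp only [mul_assoc]

theorem xi_mul_xi_mem (hk : 1 ≤ P.k) (hq0 : P.qc 0 = (P.q0 : R)) {i₁ j₁ i₂ j₂ q : ℕ} (hi : 1 ≤ i₁)
    (hi₂ : i₁ ≤ i₂) (hij : i₂ < j₁) (hjq : j₁ ≤ q + 2) (hij₂ : i₂ ≤ j₂) (hjq₂ : j₂ ≤ q)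
    (hq : q + 2 < P.n) :
    ∃ x ∈ NN P (q + 2) fun i u => i₂ + 1 ≤ i ∧ -0 ≤ u ∧ u ≤ 0,
      xi P i₁ j₁ (q + 2) * xi P i₂ j₂ q = x * Eg P q := by
  obtain ⟨d, hd, h⟩ := xi_mul_Gen (P := P) hi (hi₂.trans hij.le) hi₂ hij hq hjq
    (mul_mem (Xs_mem_Gen (P := P) (i := i₂) (j := j₂) (b := q - 1) le_rfl (by omega))
      (Es_mem_Gen (P := P) hij₂ (le_refl (q - 1))))
  have hd' : d * Xs P (j₁ + 1) (q + 2 + 1) ∈ Gen P (i₂ + 1) (q + 2) :=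
    mul_mem hd (Xs_mem_Gen (by omega) le_rfl)
  have hx := Gen_mul_mem_NN hk hq0 (show 1 ≤ i₂ + 1 by omega) hq 0 hd'
    (gen_mul_mem_NN (P := P) (i := q + 1) (j := q + 1) (r := q + 2) (s := 0)
      (S := fun i' u => i₂ + 1 ≤ i' ∧ -0 ≤ u ∧ u ≤ 0) (by omega) le_rfl (by omega) (by omega)
      (Xs_mem_Bsub hi (show q ≤ q + 2 - 1 by omega)))
  refine ⟨_, hx, ?_⟩
  rw [xi_eq_mul_E (by omega) hjq₂, ← mul_assoc, h, xi_eq_Xs_mul_xi_self hi (by omega) hjq hq,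
    mul_assoc, mul_assoc, xi_mul_E hi (by omega) hq]
  simp only [mul_assoc, Zp_zero, one_mul]

theorem alpha_mul_alpha_mem_NE (hk : 1 ≤ P.k) (hq0 : P.qc 0 = (P.q0 : R)) {i₁ j₁ i₂ j₂ q : ℕ}
    {s₁ s₂ : ℤ} (hi : 1 ≤ i₁) (hij : i₁ ≤ j₁) (hjq : j₁ ≤ q + 2) (hi₂ : i₁ ≤ i₂) (hij₂ : i₂ ≤ j₂)
    (hjq₂ : j₂ ≤ q) (hq : q + 2 < P.n) (hs : s₂ ∈ Pset P.k) :
    alpha P i₁ j₁ (q + 2) s₁ * alpha P i₂ j₂ q s₂ ∈ NE P i₁ q := by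
  rw [alpha_eq, alpha_eq, mul_assoc]
  rcases Nat.lt_or_ge i₂ j₁ with hlt | hge
  swap
  · exact Zp_mul_xi_mul_mem_NE hi hij hge hij₂ hjq₂ hq hs (Zp_mem_Low hi (by omega) s₁)
  have hs' := hs
  simp only [Pset, Set.mem_ofPred_eq] at hs'
  have hlow : ∀ s, Zp P i₂ s ∈ Low P (i₂ + 1) :=
    Zp_mem_Low (by omega) (Nat.lt_succ_self i₂)
  have hu : Zp P i₁ s₁ * Xs P i₁ i₂ ∈ Low P (i₂ + 1) :=
    mul_mem (Zp_mem_Low hi (by omega) s₁)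
      (Bsub_le_Low (Nat.lt_succ_self i₂) (by omega) (Xs_mem_Bsub hi le_rfl))
  have hcomm : ∀ s, Commute (Zp P i₂ s) (xi P (i₂ + 1) j₁ (q + 2)) :=
    fun s => Low_commute_xi hlt (hlow s)
  have hsplit : ∀ x, Zp P i₁ s₁ * (xi P i₁ j₁ (q + 2) * x) =
      Zp P i₁ s₁ * Xs P i₁ i₂ * (Xg P i₂ * (xi P (i₂ + 1) j₁ (q + 2) * x)) := by
    intro x
    rw [← Xs_mul_xi hi₂ hlt.le, xi_left hlt]
    simp only [mul_assoc]
  rw [hsplit, ← (hcomm s₂).left_comm]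
  refine mem_of_sub_mem (pass_left_sub (by omega) (by omega) _ s₂ _ (fun a ha => ?_)
    fun a ha => ?_) ?_
  · rw [(hcomm _).left_comm, xi_eq_mul_E (by omega) hjq₂, ← mul_assoc (Zp P i₂ _),
      ← mul_assoc (xi P _ _ _), ← mul_assoc (Zp P (i₂ + 1) _), ← mul_assoc]
    refine mul_E_mem_NE (mul_gen_mem_NN (by omega) hlt hjq hq ⟨by omega, ?_⟩ hu
      (mul_mem (Zp_mem_Bsub (by omega) (by omega) _) (Xs_mul_Es_mem_Bsub (by omega) hij₂ hjq₂)))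
    unfold Bt at ha
    simp only [Pset, Set.mem_ofPred_eq]
    omega
  · rw [Zp_succ_mul_E_mul (by omega) (by omega), (hcomm _).left_comm, ← mul_assoc]
    unfold Bt at ha
    obtain ⟨x, hx, h⟩ := E_mul_xi_mul_mem_NN (P := P) (s := s₂ - a) (b := (s₂ - a).natAbs) hk hq0
      (hi.trans hi₂) hlt hjq hij₂ hjq₂ hq (by omega) (by omega)
    rw [h, ← mul_assoc]
    refine mul_E_mem_NE (NN_mono (fun i u _ _ h => ⟨by omega, ?_⟩) (Low_mul_mem_NN hq
      (fun i u h => h.1) (Low_mono (Nat.le_succ _) (mul_mem hu (hlow _))) hx))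
    simp only [Pset, Set.mem_ofPred_eq]
    omega
  · obtain ⟨x, hx, h⟩ := xi_mul_xi_mem (P := P) hk hq0 hi hi₂ hlt hjq hij₂ hjq₂ hq
    rw [← (Zp_commute_Low hu (by omega) le_rfl (by omega) s₂).left_comm, ← hsplit, h,
      ← mul_assoc (Zp P i₁ s₁), ← mul_assoc]
    refine mul_E_mem_NE (mul_mem_NN_left (fun i j u h1 h2 h3 h4 => ?_) (Low_mul_mem_NN hq
      (fun i u h => h.1) (Zp_mem_Low hi (Nat.lt_succ_of_le hi₂) s₁) hx))
    obtain rfl : u = 0 := by omega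
    rcases Nat.eq_or_lt_of_le h4.1 with rfl | h5
    · rw [Zp_mul_Zp_mul, add_zero]
      exact gen_mem_NN h1 h2 h3 ⟨by omega, hs⟩
    · simpa using mul_gen_mem_NN (S := fun i u => i₁ < i ∧ u ∈ Pset P.k) (s := 0) h1 h2 h3 hq
        ⟨by omega, by simp only [Pset, Set.mem_ofPred_eq]; omega⟩
        (Zp_mem_Low (by omega) h5 s₂) (one_mem _)

/-! ### Chains of `α`s -/

theorem alphaChain_succ (l : ℕ) (ii jj : ℕ → ℕ) (ss : ℕ → ℤ) (m : ℕ) :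
    alphaChain P (l + 2) ii jj ss (m + 1) = alpha P (ii 1) (jj 1) (l + 1) (ss 1) *
      alphaChain P l (fun t => ii (t + 1)) (fun t => jj (t + 1)) (fun t => ss (t + 1)) m := by
  induction m with
  | zero => simp [alphaChain]
  | succ m ih =>
    rw [alphaChain, ih, alphaChain, mul_assoc,
      show l + 2 + 1 - 2 * (m + 1 + 1) = l + 1 - 2 * (m + 1) by omega]

theorem Echain_succ (l m : ℕ) :
    Echain P (l + 2) (m + 1) = Eg P (l + 1) * Echain P l m := by
  induction m with
  | zero => simp [Echain]
  | succ m ih =>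
    rw [Echain, ih, Echain, mul_assoc,
      show l + 2 + 1 - 2 * (m + 1 + 1) = l + 1 - 2 * (m + 1) by omega]

/-- The module `V_{l,m} B_{l-2m}`. -/
def VB (P : Params R) (l m : ℕ) : Submodule R (Alg P) :=
  Submodule.span R {z | ∃ v b, v ∈ V P l m ∧ b ∈ Bsub P (l - 2 * m) ∧ z = v * b}

theorem alphaChain_eq_mul_Echain {m l : ℕ} (hml : 2 * m ≤ l) (hln : l ≤ P.n) {ii jj : ℕ → ℕ}
    {ss : ℕ → ℤ} (h : ∀ t, 1 ≤ t → t ≤ m → 1 ≤ ii t ∧ ii t ≤ jj t ∧ jj t ≤ l + 1 - 2 * t) :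
    ∃ y ∈ Low P (l + 1), alphaChain P l ii jj ss m = y * Echain P l m := by
  induction m generalizing l ii jj ss with
  | zero => exact ⟨1, one_mem _, by simp [alphaChain, Echain]⟩
  | succ m ih =>
    obtain ⟨l, rfl⟩ := Nat.exists_eq_add_of_le' (show 2 ≤ l by omega)
    obtain ⟨y, hy, hy'⟩ := ih (l := l) (ii := fun t => ii (t + 1)) (jj := fun t => jj (t + 1))
      (ss := fun t => ss (t + 1)) (by omega) (by omega) fun t h1 h2 => by
        have := h (t + 1) (by omega) (by omega)
        omega
    obtain ⟨h1, h2, h3⟩ := h 1 le_rfl (by omega)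
    refine ⟨Zp P (ii 1) (ss 1) * (Xs P (ii 1) (jj 1) * Es P (jj 1) l) * y,
      Bsub_le_Low (Nat.lt_succ_self (l + 2)) (by omega) (mul_mem (mul_mem (Zp_mem_Bsub h1 (by omega) _)
        (mul_mem (Xs_mem_Bsub h1 (by omega)) (Es_mem_Bsub (by omega) (by omega))))
        (Low_le_Bsub (by omega) hy)), ?_⟩
    rw [alphaChain_succ, hy', alpha_eq, xi_eq_mul_E (by omega) (by omega), Echain_succ,
      Nat.add_sub_cancel]
    simp only [mul_assoc]
    rw [(E_commute_Low hy le_rfl).left_comm]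

theorem alpha_mul_mem_VB (hk : 1 ≤ P.k) (hq0 : P.qc 0 = (P.q0 : R)) {m l : ℕ} (hml : 2 * m ≤ l)
    (hln : l + 2 ≤ P.n)
    (ih : ∀ x ∈ Bsub P l, ∀ b ∈ Bsub P (l - 2 * m), x * (Echain P l m * b) ∈ VB P l m)
    {i j : ℕ} {s : ℤ} (hi : 1 ≤ i) (hij : i ≤ j) (hjl : j ≤ l + 1) (hs : s ∈ Pset P.k)
    {y : Alg P} (hy : y ∈ VB P l m) : alpha P i j (l + 1) s * y ∈ VB P (l + 2) (m + 1) := by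
  obtain ⟨d, hd⟩ := Nat.exists_eq_add_of_le (hij.trans hjl)
  induction d using Nat.strong_induction_on generalizing i j s y with
  | _ d IH =>
  have : VB P l m ≤ (VB P (l + 2) (m + 1)).comap (LinearMap.mulLeft R (alpha P i j (l + 1) s)) := by
    refine Submodule.span_le.2 ?_
    rintro _ ⟨_, b, ⟨ii, jj, ss, h1, h2, rfl⟩, hb, rfl⟩
    change alpha P i j (l + 1) s * (alphaChain P l ii jj ss m * b) ∈ VB P (l + 2) (m + 1)
    by_cases hc : 1 ≤ m → ii 1 < i
    · refine Submodule.subset_span ⟨_, b, ⟨fun t => if t = 1 then i else ii (t - 1),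
        fun t => if t = 1 then j else jj (t - 1), fun t => if t = 1 then s else ss (t - 1),
        fun t ht ht' => ?_, fun t ht ht' => ?_, rfl⟩, ?_, ?_⟩
      · by_cases h : t = 1
        · simp only [h, if_true]
          exact ⟨hi, hij, by omega, hs⟩
        · simp only [h, if_false]
          obtain ⟨a, b, c, d⟩ := h1 (t - 1) (by omega) (by omega)
          exact ⟨a, b, by omega, d⟩
      · by_cases h : t = 1
        · subst h
          simpa using hc (by omega)
        · obtain ⟨t, rfl⟩ := Nat.exists_eq_add_of_le' (show 1 ≤ t from ht)
          simpa [show t ≠ 0 by omega] using h2 t (by omega) (by omega)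
      · rwa [show l + 2 - 2 * (m + 1) = l - 2 * m by omega]
      · have hch : ∀ k, alphaChain P l (fun t => if t + 1 = 1 then i else ii (t + 1 - 1))
            (fun t => if t + 1 = 1 then j else jj (t + 1 - 1))
            (fun t => if t + 1 = 1 then s else ss (t + 1 - 1)) k = alphaChain P l ii jj ss k := by
          intro k
          induction k with
          | zero => rfl
          | succ k ih => simp [alphaChain, ← ih]
        rw [alphaChain_succ, hch, mul_assoc]
        simp
    · push Not at hc
      obtain ⟨hm, hc⟩ := hc
      obtain ⟨m, rfl⟩ := Nat.exists_eq_add_of_le' hm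
      obtain ⟨l, rfl⟩ := Nat.exists_eq_add_of_le' (show 2 ≤ l by omega)
      obtain ⟨y, hy, hy'⟩ := alphaChain_eq_mul_Echain (P := P) (l := l) (m := m)
        (ii := fun t => ii (t + 1)) (jj := fun t => jj (t + 1))
        (ss := fun t => ss (t + 1)) (by omega) (by omega) fun t ht ht' => by
          have := h1 (t + 1) (by omega) (by omega)
          omega
      obtain ⟨g1, g2, g3, g4⟩ := h1 1 le_rfl (by omega)
      obtain ⟨x, hx, h⟩ := alpha_mul_alpha_mem_NE (P := P) (s₁ := s) (q := l + 1) hk hq0 hi hij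
        hjl hc g2 (by omega) (by omega) g4
      rw [alphaChain_succ, mul_assoc, ← mul_assoc (alpha P i j _ s), ← h, LinearMap.mulRight_apply,
        hy']
      simp only [mul_assoc]
      rw [(E_commute_Low hy le_rfl).left_comm, mul_assoc_of_eq (Echain_succ l m).symm]
      have hle : (NN P (l + 1 + 2) fun i' u => i < i' ∧ u ∈ Pset P.k) ≤
          (VB P (l + 2 + 2) (m + 1 + 1)).comap
            (LinearMap.mulRight R (y * (Echain P (l + 2) (m + 1) * b))) := by
        refine NN_le fun i' j' u c a1 a2 a3 a4 a5 => ?_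
        rw [Submodule.mem_comap, LinearMap.mulRight_apply, ← mul_assoc (Zp P i' u), ← alpha_eq,
          mul_assoc, ← mul_assoc c]
        exact IH (l + 2 + 1 - i') (by omega) a1 a2 a3 a4.2
          (ih _ (mul_mem a5 (Low_le_Bsub (by omega) hy)) b hb) (by omega)
      exact hle hx
  exact this hy

theorem Bsub_mul_Echain_mul_mem_VB (hk : 1 ≤ P.k) (hq0 : P.qc 0 = (P.q0 : R)) {m l : ℕ}
    (hml : 2 * m ≤ l) (hln : l ≤ P.n) {x b : Alg P} (hx : x ∈ Bsub P l)
    (hb : b ∈ Bsub P (l - 2 * m)) : x * (Echain P l m * b) ∈ VB P l m := by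
  induction m generalizing l x b with
  | zero =>
    refine Submodule.subset_span ⟨1, x * b, ⟨fun _ => 0, fun _ => 0, fun _ => 0, by omega, by omega,
      rfl⟩, mul_mem hx hb, by simp [Echain]⟩
  | succ m ih =>
    obtain ⟨l, rfl⟩ := Nat.exists_eq_add_of_le' (show 2 ≤ l by omega)
    rw [show l + 2 - 2 * (m + 1) = l - 2 * m by omega] at hb
    have hle : NP P (l + 1) ≤ (VB P (l + 2) (m + 1)).comap
        (LinearMap.mulRight R (Echain P l m * b)) := by
      refine NN_le fun i j s c h1 h2 h3 h4 h5 => ?_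
      rw [Submodule.mem_comap, LinearMap.mulRight_apply, ← mul_assoc (Zp P i s), ← alpha_eq,
        mul_assoc]
      exact alpha_mul_mem_VB hk hq0 (by omega) hln
        (fun x hx b hb => ih (by omega) (by omega) hx hb) h1 h2 h3 h4
        (ih (by omega) (by omega) h5 hb)
    rw [Echain_succ, mul_assoc, ← mul_assoc]
    exact hle (Bsub_mul_E_mem_NP hk hq0 (by omega) (by omega) hx)

theorem Vg_mul_mem_VB (hk : 1 ≤ P.k) (hq0 : P.qc 0 = (P.q0 : R)) {m l : ℕ}
    (hml : 2 * m ≤ l) (hln : l ≤ P.n) {v b : Alg P} (hv : v ∈ Vg P l m)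
    (hb : b ∈ Bsub P (l - 2 * m)) : v * b ∈ VB P l m := by
  obtain ⟨ii, jj, ss, h, rfl⟩ := hv
  obtain ⟨y, hy, h'⟩ := alphaChain_eq_mul_Echain (P := P) (ss := ss) hml hln
    fun t h1 h2 => ⟨(h t h1 h2).1, (h t h1 h2).2.1, (h t h1 h2).2.2.1⟩
  rw [h', mul_assoc]
  exact Bsub_mul_Echain_mul_mem_VB hk hq0 hml hln (Low_le_Bsub le_rfl hy) hb

end CBMW

/-- Lemma 11 of the paper. `V_{l,m}^g ⬝ B_{l-2m} = V_{l,m} ⬝ B_{l-2m}`. -/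
theorem statement10 {R : Type} [CommRing R] (P : Params R)
    (hn : 1 ≤ P.n) (hk : 1 ≤ P.k) (hq0 : P.qc 0 = (P.q0 : R))
    (hcomp : (P.lam : R) - P.laminv = P.delta * (1 - P.A 0))
    (m l : ℕ) (hml : 2 * m ≤ l) (hln : l ≤ P.n) :
    Submodule.span R
        {z : Alg P | ∃ v b, v ∈ Vg P l m ∧ b ∈ Bsub P (l - 2 * m) ∧ z = v * b}
      = Submodule.span R
          {z : Alg P | ∃ v b, v ∈ V P l m ∧ b ∈ Bsub P (l - 2 * m) ∧ z = v * b} := by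
  refine le_antisymm (Submodule.span_le.2 ?_) (Submodule.span_mono ?_)
  · rintro _ ⟨v, b, hv, hb, rfl⟩
    exact Vg_mul_mem_VB hk hq0 hml hln hv hb
  · rintro _ ⟨_, b, ⟨ii, jj, ss, h, -, rfl⟩, hb, rfl⟩
    exact ⟨_, b, ⟨ii, jj, ss, h, rfl⟩, hb, rfl⟩
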